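/- arXiv:1908.06533 — 10 statements merged into one kernel-verified Lean document; each statement's English description precedes it below -/
import Mathlib

section
/- Let x : ℝ → ℝ be a twice differentiable solution of the double-well Duffing equation x''(t) − x(t) + x(t)³ = 0 that is not identically zero, and let E = (1/2)·x'(t)² − (1/2)·x(t)² + (1/4)·x(t)⁴ denote its (constant) energy. Then the phase-plane trajectory S = {(x(t), x'(t)) : t ∈ ℝ} ⊆ ℝ² is point symmetric to the origin (i.e., S = −S) if and only if E > 0. -/
open Set

/-- A plane curve avoiding the axis `g = 0` cannot rotate with angular speed bounded below
for all times. -/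
theorem exists_eq_zero_of_angular_speed_ge {f g f' g' : ℝ → ℝ} {c : ℝ} (hc : 0 < c)
    (hf : ∀ t, HasDerivAt f (f' t) t) (hg : ∀ t, HasDerivAt g (g' t) t)
    (h : ∀ t, c * (g t ^ 2 + f t ^ 2) ≤ f' t * g t - f t * g' t) : ∃ t, g t = 0 := by
  by_contra! h0
  have hd (t : ℝ) : HasDerivAt (fun s => Real.arctan (f s / g s))
      (1 / (1 + (f t / g t) ^ 2) * ((f' t * g t - f t * g' t) / g t ^ 2)) t :=
    ((hf t).div (hg t) (h0 t)).arctan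
  have hle (t : ℝ) : c ≤ deriv (fun s => Real.arctan (f s / g s)) t := by
    have hg2 : 0 < g t ^ 2 := by have := h0 t; positivity
    have : 1 / (1 + (f t / g t) ^ 2) * ((f' t * g t - f t * g' t) / g t ^ 2)
        = (f' t * g t - f t * g' t) / (g t ^ 2 + f t ^ 2) := by
      have := h0 t
      field_simp
    rw [(hd t).deriv, this, le_div_iff₀ (by positivity)]
    exact h t
  have hT : 0 ≤ Real.pi / c := by positivity
  have := mul_sub_le_image_sub_of_le_deriv (fun t => (hd t).differentiableAt) hle hT
  rw [sub_zero, mul_div_cancel₀ _ hc.ne'] at this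
  linarith [Real.arctan_lt_pi_div_two (f (Real.pi / c) / g (Real.pi / c)),
    Real.neg_pi_div_two_lt_arctan (f 0 / g 0)]

/-- Bounded solutions of the double-well Duffing system are determined by their value at
one time. -/
theorem doubleWell_eq_of_eq_at {x v y w : ℝ → ℝ} {R t₀ : ℝ}
    (hx : ∀ t, HasDerivAt x (v t) t) (hv : ∀ t, HasDerivAt v (x t - x t ^ 3) t)
    (hy : ∀ t, HasDerivAt y (w t) t) (hw : ∀ t, HasDerivAt w (y t - y t ^ 3) t)
    (hxR : ∀ t, x t ^ 2 + v t ^ 2 ≤ R) (hyR : ∀ t, y t ^ 2 + w t ^ 2 ≤ R)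
    (h₁ : x t₀ = y t₀) (h₂ : v t₀ = w t₀) (t : ℝ) : x t = y t ∧ v t = w t := by
  let F : ℝ × ℝ → ℝ × ℝ := fun p => (p.2, p.1 - p.1 ^ 3)
  have hF : ContDiff ℝ 1 F := by fun_prop
  obtain ⟨K, hK⟩ := hF.contDiffOn.exists_lipschitzOnWith (s := Metric.closedBall 0 (R + 1))
    one_ne_zero (convex_closedBall _ _) (isCompact_closedBall _ _)
  have hmem {a b : ℝ} (h : a ^ 2 + b ^ 2 ≤ R) :
      (a, b) ∈ Metric.closedBall (0 : ℝ × ℝ) (R + 1) := by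
    rw [mem_closedBall_zero_iff, Prod.norm_def, max_le_iff, Real.norm_eq_abs, Real.norm_eq_abs]
    constructor <;> refine abs_le.2 ⟨?_, ?_⟩ <;>
      nlinarith [sq_nonneg (a - 1), sq_nonneg (a + 1), sq_nonneg (b - 1), sq_nonneg (b + 1)]
  have := ODE_solution_unique_univ (v := fun _ => F) (s := fun _ => Metric.closedBall 0 (R + 1))
    (f := fun t => (x t, v t)) (g := fun t => (y t, w t)) (K := K) (t₀ := t₀) (fun _ => hK)
    (fun t => ⟨(hx t).prodMk (hv t), hmem (hxR t)⟩)
    (fun t => ⟨(hy t).prodMk (hw t), hmem (hyR t)⟩) (by simp [h₁, h₂])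
  simpa using congrFun this t

/-- for a nonzero solution of the double-well Duffing equation,
the phase-plane trajectory is point symmetric to the origin iff the energy is positive. -/
theorem doubleWell_orbit_symmetric_iff_energy_pos
    (x : ℝ → ℝ) (hx : Differentiable ℝ x) (hx' : Differentiable ℝ (deriv x))
    (hode : ∀ t : ℝ, deriv (deriv x) t - x t + (x t) ^ 3 = 0)
    (hne : x ≠ 0)
    (E : ℝ)
    (hE : ∀ t : ℝ, (1/2) * (deriv x t) ^ 2 - (1/2) * (x t) ^ 2 + (1/4) * (x t) ^ 4 = E) :
    (Set.range (fun t : ℝ => (x t, deriv x t))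
      = -Set.range (fun t : ℝ => (x t, deriv x t))) ↔ 0 < E := by
  have hdx (t : ℝ) : HasDerivAt x (deriv x t) t := (hx t).hasDerivAt
  have hdv (t : ℝ) : HasDerivAt (deriv x) (x t - x t ^ 3) t := by
    have := (hx' t).hasDerivAt
    rwa [show deriv (deriv x) t = x t - x t ^ 3 by linarith [hode t]] at this
  have hR (t : ℝ) : x t ^ 2 + deriv x t ^ 2 ≤ 2 * E + 2 := by
    nlinarith [hE t, sq_nonneg (x t ^ 2 - 2)]
  constructor
  · intro hS
    by_contra! hE0
    have hx0 (t : ℝ) : x t ≠ 0 := by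
      intro h
      have hv : deriv x t = 0 := by
        have := hE t
        rw [h] at this
        exact pow_eq_zero_iff two_ne_zero |>.1 (le_antisymm (by linarith) (sq_nonneg _))
      refine hne (funext fun s => (doubleWell_eq_of_eq_at (y := 0) (w := 0) (t₀ := t) hdx hdv
        (fun s => hasDerivAt_const s 0) (fun s => ?_) hR (fun s => ?_) h hv s).1)
      · simp
      · have := hR s
        simp only [Pi.zero_apply]
        nlinarith [sq_nonneg (x s), sq_nonneg (deriv x s)]
    have hmem : (x 0, deriv x 0) ∈ -range fun t => (x t, deriv x t) := hS ▸ mem_range_self 0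
    obtain ⟨s, hs⟩ := hmem
    have hs' : x s = -x 0 := congrArg Prod.fst hs
    have hz : (0 : ℝ) ∈ uIcc (x 0) (x s) := by
      rw [hs', mem_uIcc]
      rcases le_total 0 (x 0) with h | h
      · right; constructor <;> linarith
      · left; constructor <;> linarith
    obtain ⟨t, -, ht⟩ := intermediate_value_uIcc hx.continuous.continuousOn hz
    exact hx0 t ht
  · intro hE0
    have hc : 0 < E / (E + 1) := by positivity
    have hspeed (t : ℝ) : E / (E + 1) * (deriv x t ^ 2 + x t ^ 2)
        ≤ deriv x t * deriv x t - x t * (x t - x t ^ 3) := by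
      have h₁ : E / (E + 1) * (deriv x t ^ 2 + x t ^ 2) ≤ E / (E + 1) * (2 * E + 2) :=
        mul_le_mul_of_nonneg_left (by linarith [hR t]) hc.le
      have h₂ : E / (E + 1) * (2 * E + 2) = 2 * E := by field_simp
      nlinarith [hE t, sq_nonneg (x t ^ 2)]
    obtain ⟨a, ha⟩ := exists_eq_zero_of_angular_speed_ge hc hdx hdv hspeed
    obtain ⟨b, hb⟩ := exists_eq_zero_of_angular_speed_ge (f := fun t => -deriv x t) hc
      (fun t => (hdv t).neg) hdx (fun t => by linarith [hspeed t])
    have hrx (p t : ℝ) : HasDerivAt (fun s => x (p - s)) (-deriv x (p - t)) t :=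
      (hdx (p - t)).comp_const_sub p t
    have hrv (p t : ℝ) :
        HasDerivAt (fun s => deriv x (p - s)) (-(x (p - t) - x (p - t) ^ 3)) t :=
      (hdv (p - t)).comp_const_sub p t
    have hrefl_a (t : ℝ) : x t = x (2 * a - t) ∧ deriv x t = -deriv x (2 * a - t) := by
      refine doubleWell_eq_of_eq_at (t₀ := a) (y := fun t => x (2 * a - t))
        (w := fun t => -deriv x (2 * a - t)) hdx hdv (hrx _) (fun t => ?_) hR
        (fun t => by simpa using hR (2 * a - t)) ?_ ?_ t
      · simpa using (hrv (2 * a) t).fun_neg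
      · ring_nf
      · ring_nf
        simp [ha]
    have hrefl_b (t : ℝ) : x t = -x (2 * b - t) ∧ deriv x t = deriv x (2 * b - t) := by
      refine doubleWell_eq_of_eq_at (t₀ := b) (y := fun t => -x (2 * b - t))
        (w := fun t => deriv x (2 * b - t)) hdx hdv (fun t => ?_) (fun t => ?_) hR
        (fun t => by simpa using hR (2 * b - t)) ?_ ?_ t
      · simpa using (hrx (2 * b) t).fun_neg
      · convert hrv (2 * b) t using 1
        ring
      · ring_nf
        simp [hb]
      · ring_nf
    have hneg (t : ℝ) : -(x t, deriv x t) ∈ range fun t => (x t, deriv x t) := by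
      refine ⟨2 * b - (2 * a - t), ?_⟩
      have h₁ := hrefl_a t
      have h₂ := hrefl_b (2 * a - t)
      ext <;> simp <;> linarith
    ext p
    constructor
    · rintro ⟨t, rfl⟩
      exact hneg t
    · rintro ⟨t, ht⟩
      have := hneg t
      rwa [show (x t, deriv x t) = -p from ht, neg_neg] at this
end

section
/- Let x : ℝ → ℝ be a twice differentiable solution of the double-well Duffing equation x''(t) − x(t) + x(t)³ = 0 whose (constant) energy E = (1/2)·x'(t)² − (1/2)·x(t)² + (1/4)·x(t)⁴ is strictly positive. Then x is a nonconstant periodic function: there exists a smallest p > 0 such that x(t + p) = x(t) for all t ∈ ℝ. -/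
namespace DoubleWell

lemma sq_le_of_energy {a b E : ℝ}
    (h : (1/2) * b ^ 2 - (1/2) * a ^ 2 + (1/4) * a ^ 4 = E) (hE : 0 < E) :
    a ^ 2 ≤ 2 + 2 * E := by
  have h1 : (a ^ 2 - 1) ^ 2 ≤ (1 + 2 * E) ^ 2 := by
    nlinarith [sq_nonneg b, sq_nonneg E]
  linarith [abs_le_of_sq_le_sq' h1 (by linarith)]

/-- Along a positive-energy solution the phase angle `arctan (y / x)` decreases at a uniform rate,
so `x` vanishes in every half-line. -/
lemma exists_zero_ge {x y : ℝ → ℝ} {E : ℝ}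
    (hx : ∀ t, HasDerivAt x (y t) t) (hy : ∀ t, HasDerivAt y (x t - x t ^ 3) t)
    (hE : ∀ t, (1/2) * (y t) ^ 2 - (1/2) * (x t) ^ 2 + (1/4) * (x t) ^ 4 = E)
    (hEpos : 0 < E) (T : ℝ) : ∃ t, T ≤ t ∧ x t = 0 := by
  by_contra! hne
  have hc : 0 < E / (E + 1) := by positivity
  set c := E / (E + 1) with hcdef
  have hd : ∀ t, T ≤ t → HasDerivAt (fun s => Real.arctan (y s / x s) + c * s)
      (1 / (1 + (y t / x t) ^ 2) * (((x t - x t ^ 3) * x t - y t * y t) / x t ^ 2) + c * 1) t :=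
    fun t ht => ((hy t).div (hx t) (hne t ht)).arctan.add ((hasDerivAt_id t).const_mul c)
  have hanti : AntitoneOn (fun s => Real.arctan (y s / x s) + c * s) (Set.Ici T) := by
    refine antitoneOn_of_deriv_nonpos (convex_Ici T)
      (fun t ht => (hd t ht).continuousAt.continuousWithinAt)
      (fun t ht => (hd t (interior_subset ht)).differentiableAt.differentiableWithinAt) ?_
    intro t ht
    have hxt := hne t (interior_subset ht)
    rw [(hd t (interior_subset ht)).deriv]
    have hpos : 0 < x t ^ 2 + y t ^ 2 := by positivity
    have heq : 1 / (1 + (y t / x t) ^ 2) * (((x t - x t ^ 3) * x t - y t * y t) / x t ^ 2) + c * 1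
        = (c * (x t ^ 2 + y t ^ 2) - (x t ^ 4 - x t ^ 2 + y t ^ 2)) / (x t ^ 2 + y t ^ 2) := by
      field_simp
      ring
    rw [heq]
    refine div_nonpos_of_nonpos_of_nonneg ?_ hpos.le
    have hle : x t ^ 2 + y t ^ 2 ≤ 2 * (E + 1) := by
      nlinarith [hE t, sq_nonneg (x t ^ 2 - 2)]
    have hcE : c * (2 * (E + 1)) = 2 * E := by
      rw [hcdef]
      field_simp
    have hmul := mul_le_mul_of_nonneg_left hle hc.le
    have hx4 : 0 ≤ x t ^ 4 := by positivity
    linarith [hE t]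
  have hlt : T ≤ T + Real.pi / c := by
    have := Real.pi_pos
    have : 0 < Real.pi / c := by positivity
    linarith
  have h := hanti (Set.mem_Ici.2 le_rfl) (Set.mem_Ici.2 hlt) hlt
  simp only [mul_add, mul_div_cancel₀ _ hc.ne'] at h
  linarith [Real.arctan_lt_pi_div_two (y T / x T),
    Real.neg_pi_div_two_lt_arctan (y (T + Real.pi / c) / x (T + Real.pi / c))]

/-- A nonnegative function with `|D'| ≤ K D` that vanishes at a point vanishes identically. -/
lemma eq_zero_of_abs_deriv_le {D D' : ℝ → ℝ} {K t₀ : ℝ}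
    (hD : ∀ t, HasDerivAt D (D' t) t) (hnonneg : ∀ t, 0 ≤ D t)
    (hbound : ∀ t, |D' t| ≤ K * D t) (h₀ : D t₀ = 0) (t : ℝ) : D t = 0 := by
  have hd : ∀ k s, HasDerivAt (fun s => D s * Real.exp (k * s))
      (D' s * Real.exp (k * s) + D s * (Real.exp (k * s) * (k * 1))) s :=
    fun k s => (hD s).mul ((hasDerivAt_id s).const_mul k).exp
  have hle : ∀ k, D t * Real.exp (k * t) ≤ D t₀ * Real.exp (k * t₀) → D t = 0 := by
    intro k hk
    rw [h₀, zero_mul] at hk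
    exact le_antisymm (nonpos_of_mul_nonpos_left hk (Real.exp_pos _)) (hnonneg t)
  rcases le_total t₀ t with ht | ht
  · refine hle (-K) (antitone_of_hasDerivAt_nonpos (hd (-K)) (fun s => ?_) ht)
    have := mul_le_mul_of_nonneg_right (abs_le.1 (hbound s)).2 (Real.exp_pos (-K * s)).le
    simp only [Pi.zero_apply]
    linarith
  · refine hle K (monotone_of_hasDerivAt_nonneg (hd K) (fun s => ?_) ht)
    have := mul_le_mul_of_nonneg_right (abs_le.1 (hbound s)).1 (Real.exp_pos (K * s)).le
    simp only [Pi.zero_apply]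
    linarith

/-- A positive-energy solution is odd about each of its zeros. -/
lemma odd_about_zero {x y : ℝ → ℝ} {E : ℝ}
    (hx : ∀ t, HasDerivAt x (y t) t) (hy : ∀ t, HasDerivAt y (x t - x t ^ 3) t)
    (hE : ∀ t, (1/2) * (y t) ^ 2 - (1/2) * (x t) ^ 2 + (1/4) * (x t) ^ 4 = E)
    (hEpos : 0 < E) {t₀ : ℝ} (h₀ : x t₀ = 0) (t : ℝ) : x (2 * t₀ - t) = -x t := by
  have hr : ∀ s, HasDerivAt (fun s => 2 * t₀ - s) (-1) s :=
    fun s => (hasDerivAt_id s).const_sub (2 * t₀)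
  have hu : ∀ s, HasDerivAt (fun s => x s + x (2 * t₀ - s)) (y s + y (2 * t₀ - s) * -1) s :=
    fun s => (hx s).add ((hx (2 * t₀ - s)).comp s (hr s))
  have hv : ∀ s, HasDerivAt (fun s => y s - y (2 * t₀ - s))
      (x s - x s ^ 3 - (x (2 * t₀ - s) - x (2 * t₀ - s) ^ 3) * -1) s :=
    fun s => (hy s).sub ((hy (2 * t₀ - s)).comp s (hr s))
  have hzero := eq_zero_of_abs_deriv_le (K := 8 + 6 * E) (t₀ := t₀)
    (fun s => ((hu s).pow 2).add ((hv s).pow 2))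
    (fun s => by simp only [Pi.add_apply, Pi.pow_apply]; positivity)
    (fun s => ?_) (by simp [two_mul, h₀]) t
  · simp only [Pi.add_apply, Pi.pow_apply] at hzero
    nlinarith [sq_nonneg (x t + x (2 * t₀ - t)), sq_nonneg (y t - y (2 * t₀ - t))]
  · simp only [Pi.add_apply, Pi.pow_apply]
    have ha := sq_le_of_energy (hE s) hEpos
    have hb := sq_le_of_energy (hE (2 * t₀ - s)) hEpos
    generalize x s = a at *
    generalize x (2 * t₀ - s) = b at *
    generalize y s = p at *
    generalize y (2 * t₀ - s) = q at *
    have hq0 : 0 ≤ a ^ 2 - a * b + b ^ 2 := by nlinarith [sq_nonneg (a - b), sq_nonneg (a + b)]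
    have hq1 : a ^ 2 - a * b + b ^ 2 ≤ 6 + 6 * E := by nlinarith [sq_nonneg (a + b)]
    have hfac : |2 - (a ^ 2 - a * b + b ^ 2)| ≤ 8 + 6 * E :=
      abs_le.2 ⟨by linarith, by linarith⟩
    have huv : |2 * ((a + b) * (p - q))| ≤ (a + b) ^ 2 + (p - q) ^ 2 :=
      abs_le.2 ⟨by nlinarith [sq_nonneg (a + b + (p - q))],
        by nlinarith [sq_nonneg (a + b - (p - q))]⟩
    calc _ = |2 - (a ^ 2 - a * b + b ^ 2)| * |2 * ((a + b) * (p - q))| := by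
          rw [← abs_mul]
          congr 1
          push_cast
          ring
      _ ≤ _ := mul_le_mul hfac huv (abs_nonneg _) (by linarith)

/-- A differentiable function with continuous derivative, not stationary at some point,
that has a positive period has a least one. -/
lemma exists_isLeast_period {x : ℝ → ℝ} (hx : Differentiable ℝ x)
    (hx' : Continuous (deriv x)) {t₀ : ℝ} (h₀ : deriv x t₀ ≠ 0)
    (hper : ∃ q : ℝ, 0 < q ∧ ∀ t, x (t + q) = x t) :
    ∃ p : ℝ, IsLeast {q : ℝ | 0 < q ∧ ∀ t : ℝ, x (t + q) = x t} p := by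
  obtain ⟨δ, hδ, hball⟩ := Metric.eventually_nhds_iff.1 (hx'.continuousAt.eventually_ne h₀)
  have hset : {q : ℝ | 0 < q ∧ ∀ t : ℝ, x (t + q) = x t}
      = {q : ℝ | δ ≤ q ∧ ∀ t : ℝ, x (t + q) = x t} := by
    ext q
    refine ⟨fun ⟨hq, h⟩ => ⟨?_, h⟩, fun ⟨hq, h⟩ => ⟨hδ.trans_le hq, h⟩⟩
    by_contra! hlt
    obtain ⟨c, ⟨hc1, hc2⟩, hc⟩ := exists_deriv_eq_zero (lt_add_of_pos_right t₀ hq)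
      hx.continuous.continuousOn (h t₀).symm
    refine hball (y := c) ?_ hc
    rw [Real.dist_eq, abs_lt]
    constructor <;> linarith
  have hclosed : IsClosed {q : ℝ | δ ≤ q ∧ ∀ t : ℝ, x (t + q) = x t} := by
    simp only [Set.ofPred_and, Set.ofPred_forall]
    have := hx.continuous
    exact isClosed_Ici.inter (isClosed_iInter fun t => isClosed_eq (by fun_prop) (by fun_prop))
  obtain ⟨q, hq⟩ := hper
  have hne : {q : ℝ | δ ≤ q ∧ ∀ t : ℝ, x (t + q) = x t}.Nonempty := ⟨q, hset ▸ hq⟩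
  rw [hset]
  exact ⟨_, hclosed.isLeast_csInf hne ⟨δ, fun _ h => h.1⟩⟩

end DoubleWell

/-- positive-energy solutions of the double-well Duffing equation
are nonconstant periodic, with a minimal period. -/
theorem doubleWell_posEnergy_periodic
    (x : ℝ → ℝ) (hx : Differentiable ℝ x) (hx' : Differentiable ℝ (deriv x))
    (hode : ∀ t : ℝ, deriv (deriv x) t - x t + (x t) ^ 3 = 0)
    (E : ℝ)
    (hE : ∀ t : ℝ, (1/2) * (deriv x t) ^ 2 - (1/2) * (x t) ^ 2 + (1/4) * (x t) ^ 4 = E)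
    (hEpos : 0 < E) :
    (¬ ∃ c : ℝ, ∀ t : ℝ, x t = c) ∧
      ∃ p : ℝ, IsLeast {q : ℝ | 0 < q ∧ ∀ t : ℝ, x (t + q) = x t} p := by
  have hd : ∀ t, HasDerivAt x (deriv x t) t := fun t => (hx t).hasDerivAt
  have hd' : ∀ t, HasDerivAt (deriv x) (x t - x t ^ 3) t := fun t => by
    have h := (hx' t).hasDerivAt
    rwa [show deriv (deriv x) t = x t - x t ^ 3 by linarith [hode t]] at h
  obtain ⟨t₀, -, h₀⟩ := DoubleWell.exists_zero_ge hd hd' hE hEpos 0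
  obtain ⟨t₁, h01, h₁⟩ := DoubleWell.exists_zero_ge hd hd' hE hEpos (t₀ + 1)
  have hne : deriv x t₀ ≠ 0 := by
    intro h
    have := hE t₀
    rw [h, h₀] at this
    linarith
  refine ⟨?_, DoubleWell.exists_isLeast_period hx hx'.continuous hne
    ⟨2 * (t₁ - t₀), by linarith, fun t => ?_⟩⟩
  · rintro ⟨c, hc⟩
    rw [show x = fun _ => c from funext hc] at hne
    simp at hne
  · have h0 := DoubleWell.odd_about_zero hd hd' hE hEpos h₀ t
    have h1 := DoubleWell.odd_about_zero hd hd' hE hEpos h₁ (2 * t₀ - t)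
    rw [show t + 2 * (t₁ - t₀) = 2 * t₁ - (2 * t₀ - t) by ring, h1, h0, neg_neg]
end

section
/- Let x : ℝ → ℝ be a twice differentiable solution of the single-well Duffing equation x''(t) + x(t) + x(t)³ = 0 that is not identically zero. Then x is a nonconstant periodic function: there exists a smallest p > 0 such that x(t + p) = x(t) for all t ∈ ℝ. -/
/-- `x` solves the single-well Duffing equation with velocity `v`. -/
def IsDuffingSolution (x v : ℝ → ℝ) : Prop :=
  (∀ t, HasDerivAt x (v t) t) ∧ ∀ t, HasDerivAt v (-x t - x t ^ 3) t

namespace IsDuffingSolution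

variable {x v y w : ℝ → ℝ}

theorem neg (h : IsDuffingSolution x v) :
    IsDuffingSolution (fun t => -x t) (fun t => -v t) :=
  ⟨fun t => (h.1 t).fun_neg, fun t => (h.2 t).fun_neg.congr_deriv (by ring)⟩

theorem reflect (h : IsDuffingSolution x v) (a : ℝ) :
    IsDuffingSolution (fun t => -x (a - t)) (fun t => v (a - t)) := by
  have hr (t : ℝ) : HasDerivAt (fun s : ℝ => a - s) (-1) t := by
    simpa using (hasDerivAt_id t).const_sub a
  refine ⟨fun t => ?_, fun t => ?_⟩
  · exact ((h.1 (a - t)).comp t (hr t)).fun_neg.congr_deriv (by ring)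
  · exact ((h.2 (a - t)).comp t (hr t)).congr_deriv (by ring)

theorem energy_eq (h : IsDuffingSolution x v) (s t : ℝ) :
    2 * v s ^ 2 + 2 * x s ^ 2 + x s ^ 4 = 2 * v t ^ 2 + 2 * x t ^ 2 + x t ^ 4 := by
  have hd (t : ℝ) : HasDerivAt (fun t => 2 * v t ^ 2 + 2 * x t ^ 2 + x t ^ 4) 0 t :=
    (((((h.2 t).fun_pow 2).const_mul 2).fun_add (((h.1 t).fun_pow 2).const_mul 2)).fun_add
      ((h.1 t).fun_pow 4)).congr_deriv (by push_cast; ring)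
  exact is_const_of_deriv_eq_zero (fun t => (hd t).differentiableAt) (fun t => (hd t).deriv) s t

theorem exists_sq_le (h : IsDuffingSolution x v) : ∃ B, ∀ t, x t ^ 2 ≤ B :=
  ⟨2 * v 0 ^ 2 + 2 * x 0 ^ 2 + x 0 ^ 4, fun t => by
    rw [h.energy_eq 0 t]; nlinarith [sq_nonneg (v t), sq_nonneg (x t), sq_nonneg (x t ^ 2)]⟩

theorem eq_of_sq_le (h : IsDuffingSolution x v) (k : IsDuffingSolution y w) {B : ℝ}
    (hx : ∀ t, x t ^ 2 ≤ B) (hy : ∀ t, y t ^ 2 ≤ B) {a : ℝ} (hxy : x a = y a)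
    (hvw : v a = w a) (t : ℝ) : x t = y t := by
  set F : ℝ → ℝ := fun t => (x t - y t) ^ 2 + (v t - w t) ^ 2 with hF
  set F' : ℝ → ℝ := fun t =>
    -(2 * (x t - y t) * (v t - w t) * (x t ^ 2 + x t * y t + y t ^ 2)) with hF'
  have hFd (t : ℝ) : HasDerivAt F (F' t) t :=
    ((((h.1 t).fun_sub (k.1 t)).fun_pow 2).fun_add
      (((h.2 t).fun_sub (k.2 t)).fun_pow 2)).congr_deriv (by simp only [hF']; push_cast; ring)
  have hbound (t : ℝ) : |F' t| ≤ 3 * B * F t := by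
    have hq : |x t ^ 2 + x t * y t + y t ^ 2| ≤ 3 * B := by
      rw [abs_le]
      constructor <;>
        nlinarith [hx t, hy t, sq_nonneg (x t - y t), sq_nonneg (x t + y t), sq_nonneg (x t),
          sq_nonneg (y t)]
    have hp : |2 * (x t - y t) * (v t - w t)| ≤ F t := by
      simp only [hF]
      rw [abs_le]
      constructor <;>
        nlinarith [sq_nonneg ((x t - y t) - (v t - w t)), sq_nonneg ((x t - y t) + (v t - w t))]
    simp only [hF', abs_neg]
    rw [abs_mul, mul_comm]
    exact mul_le_mul hq hp (abs_nonneg _) ((abs_nonneg _).trans hq)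
  have hG (c t : ℝ) : HasDerivAt (fun t => F t * Real.exp (c * t))
      ((F' t + c * F t) * Real.exp (c * t)) t :=
    ((hFd t).fun_mul ((hasDerivAt_id t).const_mul c).exp).congr_deriv (by simp; ring)
  have hFa : F a = 0 := by simp [hF, hxy, hvw]
  have hle : F t ≤ 0 := by
    rcases le_total a t with hat | hta
    · have hanti : Antitone fun t => F t * Real.exp (-(3 * B) * t) :=
        antitone_of_deriv_nonpos (fun t => (hG _ t).differentiableAt) fun t => by
          rw [(hG _ t).deriv]
          exact mul_nonpos_of_nonpos_of_nonneg
            (by linarith [(abs_le.1 (hbound t)).2]) (Real.exp_pos _).le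
      have := hanti hat
      simp only [hFa, zero_mul] at this
      exact nonpos_of_mul_nonpos_left this (Real.exp_pos _)
    · have hmono : Monotone fun t => F t * Real.exp (3 * B * t) :=
        monotone_of_deriv_nonneg (fun t => (hG _ t).differentiableAt) fun t => by
          rw [(hG _ t).deriv]
          exact mul_nonneg (by linarith [(abs_le.1 (hbound t)).1]) (Real.exp_pos _).le
      have := hmono hta
      simp only [hFa, zero_mul] at this
      exact nonpos_of_mul_nonpos_left this (Real.exp_pos _)
  have : x t - y t = 0 := by
    simp only [hF] at hle
    exact pow_eq_zero_iff two_ne_zero |>.1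
      (le_antisymm (by nlinarith [sq_nonneg (v t - w t)]) (sq_nonneg _))
  linarith

/-- A Duffing solution is odd about each of its zeros. -/
theorem eq_neg_of_zero (h : IsDuffingSolution x v) {a : ℝ} (ha : x a = 0) (t : ℝ) :
    x t = -x (2 * a - t) := by
  obtain ⟨B, hB⟩ := h.exists_sq_le
  have e : 2 * a - a = a := by ring
  exact h.eq_of_sq_le (h.reflect (2 * a)) hB (fun t => by simpa using hB (2 * a - t))
    (a := a) (by simp [e, ha]) (by simp [e]) t

theorem not_forall_pos (h : IsDuffingSolution x v) (a : ℝ) :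
    ¬ ∀ t ∈ Set.Icc a (a + Real.pi), 0 < x t := by
  intro hpos
  have hs (t : ℝ) : HasDerivAt (fun t => t - a) 1 t := (hasDerivAt_id t).sub_const a
  have hW (t : ℝ) : HasDerivAt (fun t => v t * Real.sin (t - a) - x t * Real.cos (t - a))
      (-(x t ^ 3 * Real.sin (t - a))) t :=
    (((h.2 t).fun_mul (hs t).sin).fun_sub ((h.1 t).fun_mul (hs t).cos)).congr_deriv (by ring)
  have hanti := antitoneOn_of_deriv_nonpos (convex_Icc a (a + Real.pi))
    (fun t _ => (hW t).continuousAt.continuousWithinAt)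
    (fun t _ => (hW t).differentiableAt.differentiableWithinAt) (fun t ht => by
      have ht' := interior_subset ht
      rw [(hW t).deriv, neg_nonpos]
      exact mul_nonneg (pow_pos (hpos t ht') 3).le
        (Real.sin_nonneg_of_nonneg_of_le_pi (by linarith [ht'.1]) (by linarith [ht'.2])))
  have hpi := Real.pi_pos
  have hl : a ∈ Set.Icc a (a + Real.pi) := ⟨le_rfl, by linarith⟩
  have hr : a + Real.pi ∈ Set.Icc a (a + Real.pi) := ⟨by linarith, le_rfl⟩
  have := hanti hl hr (by linarith)
  simp at this
  linarith [hpos _ hl, hpos _ hr]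

theorem exists_zero (h : IsDuffingSolution x v) (a : ℝ) :
    ∃ t ∈ Set.Icc a (a + Real.pi), x t = 0 := by
  by_contra! hne
  have hcont : ContinuousOn x (Set.Icc a (a + Real.pi)) :=
    fun t _ => (h.1 t).continuousAt.continuousWithinAt
  have hzero {s t : ℝ} (hs : s ∈ Set.Icc a (a + Real.pi)) (ht : t ∈ Set.Icc a (a + Real.pi))
      (hxs : x s ≤ 0) (hxt : 0 ≤ x t) : False := by
    obtain ⟨r, hr, hxr⟩ := isPreconnected_Icc.intermediate_value hs ht hcont ⟨hxs, hxt⟩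
    exact hne r hr hxr
  have h₁ := h.not_forall_pos a
  have h₂ := h.neg.not_forall_pos a
  push Not at h₁ h₂
  obtain ⟨s, hs, hxs⟩ := h₁
  obtain ⟨t, ht, hxt⟩ := h₂
  exact hzero hs ht hxs (by linarith)

theorem exists_pos_period (h : IsDuffingSolution x v) : ∃ q > 0, Function.Periodic x q := by
  obtain ⟨a, ha, hxa⟩ := h.exists_zero 0
  obtain ⟨b, hb, hxb⟩ := h.exists_zero 4
  refine ⟨2 * (b - a), by linarith [ha.2, hb.1, Real.pi_lt_four], fun t => ?_⟩
  rw [h.eq_neg_of_zero hxb, h.eq_neg_of_zero hxa t]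
  ring_nf

end IsDuffingSolution

/-- A continuous nonconstant periodic real function has a least positive period. -/
theorem Function.Periodic.exists_isLeast_pos {x : ℝ → ℝ} (hx : Continuous x)
    (hc : ¬ ∃ c, ∀ t, x t = c) {q : ℝ} (hq : 0 < q) (hper : Function.Periodic x q) :
    ∃ p, IsLeast {q : ℝ | 0 < q ∧ ∀ t, x (t + q) = x t} p := by
  let S : AddSubgroup ℝ :=
    { carrier := {q | Function.Periodic x q}
      zero_mem' := fun t => by simp
      add_mem' := fun ha hb => ha.add_period hb
      neg_mem' := fun ha => ha.neg }
  by_contra hmin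
  have hdense : Dense (S : Set ℝ) := by
    refine S.dense_of_no_min (AddSubgroup.ne_bot_iff_exists_ne_zero.2
      ⟨⟨q, hper⟩, fun h0 => hq.ne' (congrArg Subtype.val h0)⟩) ?_
    rintro ⟨p, hp, hle⟩
    exact hmin ⟨p, ⟨hp.2, hp.1⟩, fun r hr => hle ⟨hr.2, hr.1⟩⟩
  refine hc ⟨x 0, fun t => ?_⟩
  refine congrFun (Continuous.ext_on hdense hx continuous_const fun r hr => ?_) t
  simpa using (show Function.Periodic x r from hr) 0

/-- nonzero solutions of the single-well Duffing equation
are nonconstant periodic, with a minimal period. -/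
theorem singleWell_nonzero_periodic
    (x : ℝ → ℝ) (hx : Differentiable ℝ x) (hx' : Differentiable ℝ (deriv x))
    (hode : ∀ t : ℝ, deriv (deriv x) t + x t + (x t) ^ 3 = 0)
    (hne : x ≠ 0) :
    (¬ ∃ c : ℝ, ∀ t : ℝ, x t = c) ∧
      ∃ p : ℝ, IsLeast {q : ℝ | 0 < q ∧ ∀ t : ℝ, x (t + q) = x t} p := by
  have h : IsDuffingSolution x (deriv x) :=
    ⟨fun t => (hx t).hasDerivAt,
      fun t => (hx' t).hasDerivAt.congr_deriv (by linarith [hode t])⟩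
  have hc : ¬ ∃ c : ℝ, ∀ t : ℝ, x t = c := by
    rintro ⟨c, hxc⟩
    obtain ⟨t, -, ht⟩ := h.exists_zero 0
    exact hne (funext fun s => by rw [hxc s, ← hxc t, ht, Pi.zero_apply])
  obtain ⟨q, hq, hper⟩ := h.exists_pos_period
  exact ⟨hc, hper.exists_isLeast_pos hx.continuous hc hq⟩
end

section
/- Let x : ℝ → ℝ be a twice differentiable solution of the double-well Duffing equation x''(t) − x(t) + x(t)³ = 0 with strictly positive energy E = (1/2)·x'(t)² − (1/2)·x(t)² + (1/4)·x(t)⁴ > 0, and let p > 0 be its minimal period. Then x satisfies the oddness symmetry x(t + p/2) = −x(t) for all t ∈ ℝ. -/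
/-- Bounded solutions of the double-well Duffing equation are determined by their position and
velocity at one time. -/
theorem doubleWell_unique {y z : ℝ → ℝ} {R t₀ : ℝ}
    (hy : Differentiable ℝ y) (hy' : ∀ t, HasDerivAt (deriv y) (y t - y t ^ 3) t)
    (hz : Differentiable ℝ z) (hz' : ∀ t, HasDerivAt (deriv z) (z t - z t ^ 3) t)
    (hyR : ∀ t, |y t| ≤ R) (hzR : ∀ t, |z t| ≤ R)
    (h₀ : y t₀ = z t₀) (h₀' : deriv y t₀ = deriv z t₀) : y = z := by
  have hlip : LipschitzOnWith (Real.toNNReal (1 + 3 * R ^ 2))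
      (fun q : ℝ × ℝ => (q.2, q.1 - q.1 ^ 3)) {q | |q.1| ≤ R} := by
    refine LipschitzOnWith.of_dist_le_mul ?_
    rintro ⟨a, b⟩ ha ⟨c, d⟩ hc
    simp only [Set.mem_ofPred_eq, abs_le] at ha hc
    rw [Real.coe_toNNReal _ (by positivity), Prod.dist_eq, Prod.dist_eq]
    simp only [Real.dist_eq]
    have hm₁ := le_max_left |a - c| |b - d|
    have hm₂ := le_max_right |a - c| |b - d|
    have hm₀ := (abs_nonneg (a - c)).trans hm₁
    refine max_le (by nlinarith [mul_nonneg (sq_nonneg R) hm₀]) ?_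
    have hfac : a - a ^ 3 - (c - c ^ 3) = (1 - (a ^ 2 + a * c + c ^ 2)) * (a - c) := by ring
    rw [hfac, abs_mul]
    have ha2 : a ^ 2 ≤ R ^ 2 := sq_le_sq' ha.1 ha.2
    have hc2 : c ^ 2 ≤ R ^ 2 := sq_le_sq' hc.1 hc.2
    have hcoef : |1 - (a ^ 2 + a * c + c ^ 2)| ≤ 1 + 3 * R ^ 2 :=
      abs_le.2 ⟨by nlinarith [sq_nonneg (a - c)],
        by nlinarith [sq_nonneg (a + c), sq_nonneg R]⟩
    exact mul_le_mul hcoef hm₁ (abs_nonneg _) (by positivity)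
  have huniq : (fun t => (y t, deriv y t)) = fun t => (z t, deriv z t) :=
    ODE_solution_unique_univ (v := fun _ q => (q.2, q.1 - q.1 ^ 3))
      (s := fun _ => {q | |q.1| ≤ R}) (t₀ := t₀) (fun _ => hlip)
      (fun t => ⟨(hy t).hasDerivAt.prodMk (hy' t), hyR t⟩)
      (fun t => ⟨(hz t).hasDerivAt.prodMk (hz' t), hzR t⟩) (by simp [h₀, h₀'])
  exact funext fun t => congrArg Prod.fst (congrFun huniq t)

/-- If `x` changes sign under some translation, it does so under half of its minimal period. -/
theorem antiperiodic_half_of_isLeast_period {x : ℝ → ℝ} {p s t₁ : ℝ}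
    (hp : IsLeast {q : ℝ | 0 < q ∧ ∀ t : ℝ, x (t + q) = x t} p)
    (hs : ∀ t, x (t + s) = -x t) (hne : x t₁ ≠ 0) : ∀ t, x (t + p / 2) = -x t := by
  obtain ⟨⟨hp0, hper⟩, hmin⟩ := hp
  have hper' : Function.Periodic x p := hper
  set r := toIcoMod hp0 0 s with hr
  have hr_mem : r ∈ Set.Ico 0 p := toIcoMod_mem_Ico' hp0 s
  have hxr : ∀ t, x (t + r) = -x t := fun t => by
    rw [hr, toIcoMod, ← add_sub_assoc, hper'.sub_zsmul_eq, hs]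
  have hr0 : 0 < r := by
    refine hr_mem.1.lt_of_ne fun h => hne ?_
    have := hxr t₁
    rw [← h, add_zero] at this
    linarith
  have h2r : ∀ t, x (t + 2 * r) = x t := fun t => by
    rw [two_mul, ← add_assoc, hxr, hxr, neg_neg]
  have hle : p ≤ 2 * r := hmin ⟨by linarith, h2r⟩
  have hge : 2 * r ≤ p := by
    by_contra! hlt
    have : p ≤ 2 * r - p := hmin ⟨by linarith, fun t => by
      rw [← add_sub_assoc, hper'.sub_eq, h2r]⟩
    linarith [hr_mem.2]
  have hrp : p / 2 = r := by linarith
  rwa [hrp]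

/-- oddness symmetry at half the minimal period for positive-energy
solutions of the double-well Duffing equation. -/
theorem doubleWell_half_period_oddness
    (x : ℝ → ℝ) (hx : Differentiable ℝ x) (hx' : Differentiable ℝ (deriv x))
    (hode : ∀ t : ℝ, deriv (deriv x) t - x t + (x t) ^ 3 = 0)
    (E : ℝ)
    (hE : ∀ t : ℝ, (1/2) * (deriv x t) ^ 2 - (1/2) * (x t) ^ 2 + (1/4) * (x t) ^ 4 = E)
    (hEpos : 0 < E)
    (p : ℝ) (hp : IsLeast {q : ℝ | 0 < q ∧ ∀ t : ℝ, x (t + q) = x t} p) :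
    ∀ t : ℝ, x (t + p / 2) = -x t := by
  have hper : Function.Periodic x p := hp.1.2
  have hcpt : IsCompact (Set.range x) :=
    hper.compact_of_continuous hp.1.1.ne' hx.continuous
  obtain ⟨_, ⟨t₁, rfl⟩, hmax⟩ := hcpt.exists_isGreatest (Set.range_nonempty x)
  obtain ⟨_, ⟨t₂, rfl⟩, hmin⟩ := hcpt.exists_isLeast (Set.range_nonempty x)
  replace hmax : ∀ t, x t ≤ x t₁ := fun t => hmax ⟨t, rfl⟩
  replace hmin : ∀ t, x t₂ ≤ x t := fun t => hmin ⟨t, rfl⟩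
  have hd₁ : deriv x t₁ = 0 := IsLocalMax.deriv_eq_zero (Filter.Eventually.of_forall hmax)
  have hd₂ : deriv x t₂ = 0 := IsLocalMin.deriv_eq_zero (Filter.Eventually.of_forall hmin)
  have hE₁ := hE t₁
  have hE₂ := hE t₂
  rw [hd₁] at hE₁
  rw [hd₂] at hE₂
  have hbig₁ : 2 < x t₁ ^ 2 := by nlinarith [sq_nonneg (x t₁)]
  have hbig₂ : 2 < x t₂ ^ 2 := by nlinarith [sq_nonneg (x t₂)]
  have hne : x t₁ ≠ 0 := fun h => by norm_num [h] at hbig₁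
  have hsq : x t₂ ^ 2 = x t₁ ^ 2 := by
    have hprod : (x t₂ ^ 2 - x t₁ ^ 2) * (x t₂ ^ 2 + x t₁ ^ 2 - 2) = 0 := by
      linear_combination 4 * hE₂ - 4 * hE₁
    rcases mul_eq_zero.1 hprod with h | h <;> linarith
  have hopp : x t₂ = -x t₁ := by
    rcases sq_eq_sq_iff_eq_or_eq_neg.1 hsq with h | h
    · have hconst : x = fun _ => x t₁ :=
        funext fun t => le_antisymm (hmax t) (h ▸ hmin t)
      have hdd : deriv (deriv x) t₁ = 0 := by
        rw [hconst]
        simp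
      have hcrit := hode t₁
      have : x t₁ * (x t₁ ^ 2 - 1) = 0 := by linear_combination hcrit - hdd
      rcases mul_eq_zero.1 this with h | h
      · exact absurd h hne
      · linarith
    · exact h
  have hbound : ∀ t, |x t| ≤ x t₁ := fun t => abs_le.2 ⟨hopp ▸ hmin t, hmax t⟩
  have hdd : ∀ t, HasDerivAt (deriv x) (x t - x t ^ 3) t := fun t => by
    have : deriv (deriv x) t = x t - x t ^ 3 := by linear_combination hode t
    exact this ▸ (hx' t).hasDerivAt
  set s := t₂ - t₁ with hs
  have hshift : deriv (fun t => x (t + s)) = fun t => deriv x (t + s) :=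
    funext fun t => deriv_comp_add_const x s t
  have hneg : deriv (fun t => -x t) = fun t => -deriv x t := funext fun t => deriv.fun_neg
  have hts : t₁ + s = t₂ := by rw [hs]; ring
  have hodd : (fun t => x (t + s)) = fun t => -x t := by
    refine doubleWell_unique (R := x t₁) (t₀ := t₁) (by fun_prop) (fun t => ?_) (by fun_prop)
      (fun t => ?_) (fun t => hbound _) (fun t => by rw [abs_neg]; exact hbound t) ?_ ?_
    · rw [hshift]
      exact (hdd (t + s)).comp_add_const t s
    · rw [hneg]
      refine (hdd t).fun_neg.congr_deriv ?_
      ring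
    · simp only [hts, hopp]
    · simp only [hshift, hneg, hts, hd₁, hd₂, neg_zero]
  exact antiperiodic_half_of_isLeast_period hp (congrFun hodd) hne
end

section
/- Let A > √2 and let x : ℝ → ℝ be a twice differentiable solution of the double-well Duffing equation x''(t) − x(t) + x(t)³ = 0 with initial conditions x(0) = A and x'(0) = 0. Then x is nonconstant periodic with minimal period p given by p = 4·∫₀^A du / √((A² − u²)·(A²/2 + u²/2 − 1)). -/
open intervalIntegral

/-- Angular speed, as a function of the phase `θ`, of the double-well Duffing solution of
amplitude `A` written as `A * cos θ`. -/
noncomputable def phaseSpeed (A θ : ℝ) : ℝ :=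
  Real.sqrt (A ^ 2 / 2 - 1 + A ^ 2 / 2 * Real.cos θ ^ 2)

/-- Time needed to reach the phase `θ` from the phase `0`. -/
noncomputable def phaseTime (A θ : ℝ) : ℝ := ∫ φ in (0 : ℝ)..θ, (phaseSpeed A φ)⁻¹

lemma phaseSpeed_radicand_ge (A θ : ℝ) :
    A ^ 2 / 2 - 1 ≤ A ^ 2 / 2 - 1 + A ^ 2 / 2 * Real.cos θ ^ 2 :=
  le_add_of_nonneg_right (by positivity)

lemma phaseSpeed_sq {A : ℝ} (hA : 2 < A ^ 2) (θ : ℝ) :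
    phaseSpeed A θ ^ 2 = A ^ 2 / 2 - 1 + A ^ 2 / 2 * Real.cos θ ^ 2 :=
  Real.sq_sqrt (by linarith [phaseSpeed_radicand_ge A θ])

lemma sqrt_le_phaseSpeed (A θ : ℝ) : Real.sqrt (A ^ 2 / 2 - 1) ≤ phaseSpeed A θ :=
  Real.sqrt_le_sqrt (phaseSpeed_radicand_ge A θ)

lemma phaseSpeed_pos {A : ℝ} (hA : 2 < A ^ 2) (θ : ℝ) : 0 < phaseSpeed A θ :=
  Real.sqrt_pos.2 (by linarith [phaseSpeed_radicand_ge A θ])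

lemma phaseSpeed_le {A : ℝ} (hA : 0 ≤ A) (θ : ℝ) : phaseSpeed A θ ≤ A :=
  Real.sqrt_le_iff.2 ⟨hA, by nlinarith [Real.cos_sq_le_one θ, sq_nonneg A]⟩

lemma phaseSpeed_neg (A θ : ℝ) : phaseSpeed A (-θ) = phaseSpeed A θ := by
  simp [phaseSpeed]

lemma phaseSpeed_periodic (A : ℝ) : Function.Periodic (phaseSpeed A) Real.pi := by
  intro θ
  simp [phaseSpeed, Real.cos_add_pi]

lemma hasDerivAt_phaseSpeed {A : ℝ} (hA : 2 < A ^ 2) (θ : ℝ) :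
    HasDerivAt (phaseSpeed A)
      (-(A ^ 2 * Real.cos θ * Real.sin θ) / (2 * phaseSpeed A θ)) θ := by
  have h : HasDerivAt (fun θ => A ^ 2 / 2 - 1 + A ^ 2 / 2 * Real.cos θ ^ 2)
      (-(A ^ 2 * Real.cos θ * Real.sin θ)) θ := by
    refine ((((Real.hasDerivAt_cos θ).pow 2).const_mul (A ^ 2 / 2)).const_add _).congr_deriv ?_
    push_cast
    ring
  exact h.sqrt (by linarith [phaseSpeed_radicand_ge A θ])

lemma continuous_inv_phaseSpeed {A : ℝ} (hA : 2 < A ^ 2) :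
    Continuous fun θ => (phaseSpeed A θ)⁻¹ :=
  Continuous.inv₀ (by unfold phaseSpeed; fun_prop) fun θ => (phaseSpeed_pos hA θ).ne'

lemma hasDerivAt_phaseTime {A : ℝ} (hA : 2 < A ^ 2) (θ : ℝ) :
    HasDerivAt (phaseTime A) (phaseSpeed A θ)⁻¹ θ :=
  have h := continuous_inv_phaseSpeed hA
  integral_hasDerivAt_right (h.intervalIntegrable _ _)
    h.stronglyMeasurable.stronglyMeasurableAtFilter h.continuousAt

@[simp]
lemma phaseTime_zero (A : ℝ) : phaseTime A 0 = 0 := integral_same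

lemma phaseTime_neg (A θ : ℝ) : phaseTime A (-θ) = -phaseTime A θ := by
  have h := integral_comp_neg (a := 0) (b := θ) fun φ => (phaseSpeed A φ)⁻¹
  simp only [phaseSpeed_neg, neg_zero] at h
  rw [phaseTime, phaseTime, h, integral_symm]

lemma phaseTime_add_pi {A : ℝ} (hA : 2 < A ^ 2) (θ : ℝ) :
    phaseTime A (θ + Real.pi) = phaseTime A θ + phaseTime A Real.pi := by
  have hp : Function.Periodic (fun φ => (phaseSpeed A φ)⁻¹) Real.pi := fun φ => by
    simp only [phaseSpeed_periodic A φ]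
  have h := hp.intervalIntegral_add_eq_add 0 θ
    fun _ _ => (continuous_inv_phaseSpeed hA).intervalIntegrable _ _
  rwa [zero_add] at h

lemma phaseTime_pi {A : ℝ} (hA : 2 < A ^ 2) :
    phaseTime A Real.pi = 2 * phaseTime A (Real.pi / 2) := by
  have h := phaseTime_add_pi hA (-(Real.pi / 2))
  rw [phaseTime_neg, show -(Real.pi / 2) + Real.pi = Real.pi / 2 by ring] at h
  linarith

lemma phaseTime_add_two_pi {A : ℝ} (hA : 2 < A ^ 2) (θ : ℝ) :
    phaseTime A (θ + 2 * Real.pi) = phaseTime A θ + 4 * phaseTime A (Real.pi / 2) := by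
  rw [two_mul, ← add_assoc, phaseTime_add_pi hA, phaseTime_add_pi hA, phaseTime_pi hA]
  ring

lemma strictMono_phaseTime {A : ℝ} (hA : 2 < A ^ 2) : StrictMono (phaseTime A) :=
  strictMono_of_hasDerivAt_pos (hasDerivAt_phaseTime hA)
    fun θ => inv_pos.2 (phaseSpeed_pos hA θ)

lemma surjective_phaseTime {A : ℝ} (hA0 : 0 < A) (hA : 2 < A ^ 2) :
    Function.Surjective (phaseTime A) := by
  have hmono : Monotone fun θ => phaseTime A θ - A⁻¹ * θ := by
    refine monotone_of_hasDerivAt_nonneg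
      (fun θ => (hasDerivAt_phaseTime hA θ).sub ((hasDerivAt_id θ).const_mul A⁻¹)) fun θ => ?_
    have := inv_anti₀ (phaseSpeed_pos hA θ) (phaseSpeed_le hA0.le θ)
    simpa using this
  have hcont : Continuous (phaseTime A) :=
    continuous_iff_continuousAt.2 fun θ => (hasDerivAt_phaseTime hA θ).continuousAt
  have hlin : Filter.Tendsto (fun θ : ℝ => A⁻¹ * θ) Filter.atTop Filter.atTop :=
    Filter.tendsto_id.const_mul_atTop (inv_pos.2 hA0)
  have hlin' : Filter.Tendsto (fun θ : ℝ => A⁻¹ * θ) Filter.atBot Filter.atBot :=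
    Filter.tendsto_id.const_mul_atBot (inv_pos.2 hA0)
  refine hcont.surjective (Filter.tendsto_atTop_mono' _ ?_ hlin)
    (Filter.tendsto_atBot_mono' _ ?_ hlin')
  · filter_upwards [Filter.eventually_ge_atTop 0] with θ hθ
    have := hmono hθ
    simp only [phaseTime_zero, mul_zero, sub_zero] at this
    linarith
  · filter_upwards [Filter.eventually_le_atBot 0] with θ hθ
    have := hmono hθ
    simp only [phaseTime_zero, mul_zero, sub_zero] at this
    linarith

/-- The substitution `u = A * cos φ` in the elliptic integral. -/
lemma integral_eq_phaseTime {A : ℝ} (hA0 : 0 < A) (hA : 2 < A ^ 2) :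
    ∫ u in (0 : ℝ)..A, 1 / Real.sqrt ((A ^ 2 - u ^ 2) * (A ^ 2 / 2 + u ^ 2 / 2 - 1)) =
      phaseTime A (Real.pi / 2) := by
  have hpi := Real.pi_pos
  have himage : (fun φ => A * Real.cos φ) '' Set.Ioo 0 (Real.pi / 2) = Set.Ioo 0 A := by
    ext u
    constructor
    · rintro ⟨φ, ⟨h0, h1⟩, rfl⟩
      have hc : 0 < Real.cos φ := Real.cos_pos_of_mem_Ioo ⟨by linarith, h1⟩
      have hc1 : Real.cos φ < 1 := by
        simpa using Real.cos_lt_cos_of_nonneg_of_le_pi_div_two le_rfl h1.le h0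
      exact ⟨by positivity, by nlinarith⟩
    · rintro ⟨h0, h1⟩
      refine ⟨Real.arccos (u / A), ⟨Real.arccos_pos.2 ((div_lt_one hA0).2 h1),
        Real.arccos_lt_pi_div_two.2 (by positivity)⟩, ?_⟩
      have h2 : u / A ≤ 1 := ((div_lt_one hA0).2 h1).le
      have h3 : 0 < u / A := by positivity
      simp only [Real.cos_arccos (by linarith : -1 ≤ u / A) h2]
      field_simp
  have hinj : Set.InjOn (fun φ => A * Real.cos φ) (Set.Ioo 0 (Real.pi / 2)) := by
    intro a ha b hb hab
    exact Real.injOn_cos ⟨ha.1.le, by linarith [ha.2]⟩ ⟨hb.1.le, by linarith [hb.2]⟩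
      (mul_left_cancel₀ hA0.ne' hab)
  have hsubst := MeasureTheory.integral_image_eq_integral_abs_deriv_smul measurableSet_Ioo
    (fun φ _ => ((Real.hasDerivAt_cos φ).const_mul A).hasDerivWithinAt) hinj
    fun u => 1 / Real.sqrt ((A ^ 2 - u ^ 2) * (A ^ 2 / 2 + u ^ 2 / 2 - 1))
  rw [himage] at hsubst
  rw [phaseTime, integral_of_le hA0.le, integral_of_le (by positivity),
    MeasureTheory.integral_Ioc_eq_integral_Ioo, MeasureTheory.integral_Ioc_eq_integral_Ioo, hsubst]
  refine MeasureTheory.setIntegral_congr_fun measurableSet_Ioo fun φ hφ => ?_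
  have hs : 0 < Real.sin φ := Real.sin_pos_of_pos_of_lt_pi hφ.1 (by linarith [hφ.2])
  have hw := phaseSpeed_pos hA φ
  have hrad : (A ^ 2 - (A * Real.cos φ) ^ 2) * (A ^ 2 / 2 + (A * Real.cos φ) ^ 2 / 2 - 1) =
      (A * Real.sin φ * phaseSpeed A φ) ^ 2 := by
    rw [mul_pow _ (phaseSpeed A φ), phaseSpeed_sq hA, mul_pow A (Real.sin φ), Real.sin_sq]
    ring
  simp only [hrad, smul_eq_mul, mul_neg, abs_neg]
  rw [Real.sqrt_sq (by positivity), abs_of_pos (by positivity)]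
  field_simp

/-- Conservation of energy for the double-well Duffing equation. -/
lemma doubleWell_energy {A : ℝ} {x : ℝ → ℝ} (hx : Differentiable ℝ x)
    (hx' : Differentiable ℝ (deriv x))
    (hode : ∀ t : ℝ, deriv (deriv x) t - x t + (x t) ^ 3 = 0)
    (h0 : x 0 = A) (h0' : deriv x 0 = 0) (t : ℝ) :
    deriv x t ^ 2 = (A ^ 2 - x t ^ 2) * (A ^ 2 / 2 + x t ^ 2 / 2 - 1) := by
  have hd : ∀ s, HasDerivAt
      (fun s => deriv x s ^ 2 - (A ^ 2 - x s ^ 2) * (A ^ 2 / 2 + x s ^ 2 / 2 - 1)) 0 s := by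
    intro s
    have h1 := (hx s).hasDerivAt
    have h2 := (hx' s).hasDerivAt
    refine ((h2.pow 2).sub (((h1.pow 2).const_sub (A ^ 2)).mul
      ((((h1.pow 2).div_const 2).const_add (A ^ 2 / 2)).sub_const 1))).congr_deriv ?_
    simp only [Pi.pow_apply]
    push_cast
    linear_combination (2 * deriv x s) * hode s
  have h := is_const_of_deriv_eq_zero (fun s => (hd s).differentiableAt)
    (fun s => (hd s).deriv) t 0
  simp only [h0, h0'] at h
  linear_combination h

lemma abs_le_of_doubleWell_energy {A u v : ℝ} (hA0 : 0 < A) (hA : 2 < A ^ 2)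
    (h : v ^ 2 = (A ^ 2 - u ^ 2) * (A ^ 2 / 2 + u ^ 2 / 2 - 1)) : |u| ≤ A ∧ |v| ≤ A ^ 2 := by
  have hu : u ^ 2 ≤ A ^ 2 := by
    by_contra! hlt
    nlinarith [sq_nonneg v, mul_pos (sub_pos.2 hlt)
      (by nlinarith [sq_nonneg u] : 0 < A ^ 2 / 2 + u ^ 2 / 2 - 1)]
  refine ⟨abs_le_of_sq_le_sq hu hA0.le, abs_le_of_sq_le_sq ?_ (sq_nonneg A)⟩
  rw [h, sq (A ^ 2)]
  apply mul_le_mul <;> nlinarith [sq_nonneg u]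

lemma exists_lipschitzOnWith_doubleWell (R : ℝ) :
    ∃ K, LipschitzOnWith K (fun z : ℝ × ℝ => (z.2, z.1 - z.1 ^ 3)) (Metric.closedBall 0 R) := by
  refine LocallyLipschitzOn.exists_lipschitzOnWith_of_compact (isCompact_closedBall 0 R)
    (ContDiff.locallyLipschitz (𝕂 := ℝ) ?_).locallyLipschitzOn
  fun_prop

/-- In terms of the phase, the double-well Duffing solution of amplitude `A` is `A * cos θ`. -/
lemma doubleWell_phaseTime {A : ℝ} (hA0 : 0 < A) (hA : 2 < A ^ 2)
    {x : ℝ → ℝ} (hx : Differentiable ℝ x) (hx' : Differentiable ℝ (deriv x))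
    (hode : ∀ t : ℝ, deriv (deriv x) t - x t + (x t) ^ 3 = 0)
    (h0 : x 0 = A) (h0' : deriv x 0 = 0) (θ : ℝ) :
    x (phaseTime A θ) = A * Real.cos θ := by
  let F : ℝ × ℝ → ℝ × ℝ := fun z => (z.2, z.1 - z.1 ^ 3)
  let S : Set (ℝ × ℝ) := Metric.closedBall 0 (max A (A ^ 2))
  have hS : ∀ u v : ℝ, v ^ 2 = (A ^ 2 - u ^ 2) * (A ^ 2 / 2 + u ^ 2 / 2 - 1) → (u, v) ∈ S := by
    intro u v h
    obtain ⟨hu, hv⟩ := abs_le_of_doubleWell_energy hA0 hA h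
    rw [mem_closedBall_zero_iff, Prod.norm_def]
    exact max_le_max hu hv
  obtain ⟨K, hK⟩ := exists_lipschitzOnWith_doubleWell (max A (A ^ 2))
  have hc : 0 < Real.sqrt (A ^ 2 / 2 - 1) := Real.sqrt_pos.2 (by linarith)
  let M : NNReal := ⟨(Real.sqrt (A ^ 2 / 2 - 1))⁻¹, (inv_pos.2 hc).le⟩
  have hlip : ∀ θ, LipschitzOnWith (M * K) (fun z => (phaseSpeed A θ)⁻¹ • F z) S := by
    intro θ
    refine LipschitzOnWith.of_dist_le_mul fun a ha b hb => ?_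
    have hw := phaseSpeed_pos hA θ
    rw [dist_smul₀, Real.norm_of_nonneg (inv_pos.2 hw).le, NNReal.coe_mul, mul_assoc]
    exact mul_le_mul (inv_anti₀ hc (sqrt_le_phaseSpeed A θ)) (hK.dist_le_mul a ha b hb)
      dist_nonneg M.2
  have hunique : (fun θ => (x (phaseTime A θ), deriv x (phaseTime A θ))) =
      fun θ => (A * Real.cos θ, -(A * Real.sin θ * phaseSpeed A θ)) := by
    refine ODE_solution_unique_univ (t₀ := 0) hlip (fun θ => ⟨?_, ?_⟩) (fun θ => ⟨?_, ?_⟩) ?_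
    · have hT := hasDerivAt_phaseTime hA θ
      refine (((hx _).hasDerivAt.comp θ hT).prodMk ((hx' _).hasDerivAt.comp θ hT)).congr_deriv ?_
      ext
      · simp [F, mul_comm]
      · simp only [F, Prod.smul_mk, smul_eq_mul]
        linear_combination (phaseSpeed A θ)⁻¹ * hode (phaseTime A θ)
    · exact hS _ _ (doubleWell_energy hx hx' hode h0 h0' _)
    · have hw := (phaseSpeed_pos hA θ).ne'
      refine (((Real.hasDerivAt_cos θ).const_mul A).prodMk
        ((((Real.hasDerivAt_sin θ).const_mul A).mul (hasDerivAt_phaseSpeed hA θ)).neg)).congr_deriv ?_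
      ext
      · simp only [F, Prod.smul_mk, smul_eq_mul]
        field_simp
      · simp only [F, Prod.smul_mk, smul_eq_mul]
        field_simp
        rw [phaseSpeed_sq hA, Real.sin_sq]
        ring
    · refine hS _ _ ?_
      rw [neg_sq, mul_pow _ (phaseSpeed A θ), phaseSpeed_sq hA, mul_pow A (Real.sin θ),
        Real.sin_sq]
      ring
    · simp [h0, h0']
  exact congrArg Prod.fst (congrFun hunique θ)

/-- the minimal period of the double-well Duffing solution with
amplitude `A > √2` is given by the elliptic integral. -/
theorem doubleWell_period_integral
    (A : ℝ) (hA : Real.sqrt 2 < A)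
    (x : ℝ → ℝ) (hx : Differentiable ℝ x) (hx' : Differentiable ℝ (deriv x))
    (hode : ∀ t : ℝ, deriv (deriv x) t - x t + (x t) ^ 3 = 0)
    (h0 : x 0 = A) (h0' : deriv x 0 = 0) :
    IsLeast {q : ℝ | 0 < q ∧ ∀ t : ℝ, x (t + q) = x t}
      (4 * ∫ u in (0:ℝ)..A, 1 / Real.sqrt ((A ^ 2 - u ^ 2) * (A ^ 2 / 2 + u ^ 2 / 2 - 1))) := by
  have hA0 : 0 < A := (Real.sqrt_nonneg 2).trans_lt hA
  have hA2 : 2 < A ^ 2 := (Real.sqrt_lt' hA0).1 hA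
  have hcos := doubleWell_phaseTime hA0 hA2 hx hx' hode h0 h0'
  have hmono := strictMono_phaseTime hA2
  have htwo_pi : phaseTime A (2 * Real.pi) = 4 * phaseTime A (Real.pi / 2) := by
    simpa using phaseTime_add_two_pi hA2 0
  rw [integral_eq_phaseTime hA0 hA2]
  refine ⟨⟨?_, fun t => ?_⟩, ?_⟩
  · have := hmono Real.two_pi_pos
    rwa [phaseTime_zero, htwo_pi] at this
  · obtain ⟨θ, rfl⟩ := surjective_phaseTime hA0 hA2 t
    rw [← phaseTime_add_two_pi hA2, hcos, hcos, Real.cos_add_two_pi]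
  · rintro q ⟨hq, hper⟩
    obtain ⟨θ, rfl⟩ := surjective_phaseTime hA0 hA2 q
    have hθ : 0 < θ := hmono.lt_iff_lt.1 (by rwa [phaseTime_zero])
    have hone : Real.cos θ = 1 := by
      have := hper 0
      rw [zero_add, hcos, h0] at this
      exact mul_left_cancel₀ hA0.ne' (by rw [this, mul_one])
    rw [← htwo_pi]
    refine hmono.monotone (not_lt.1 fun hlt => hθ.ne' ?_)
    exact (Real.cos_eq_one_iff_of_lt_of_lt (by linarith) hlt).1 hone
end

section
/- For every delay T > 0 and every odd natural number n ≥ 1, there exists a twice differentiable function x : ℝ → ℝ such that: x satisfies the delayed Duffing equation x''(t) + x(t − T) + x(t)³ = 0 for all t ∈ ℝ; x is nonconstant periodic with minimal period 2T/n; x satisfies the antiperiodicity relation x(t − T) = −x(t) for all t ∈ ℝ; and the amplitude of x satisfies sup_t |x(t)| > √2. -/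
open MeasureTheory Filter Set

/-- An autonomous scalar equation `θ' = g(θ)` with positive `P`-periodic right-hand side has an
increasing solution which advances by `P` in time `∫ s in 0..P, (g s)⁻¹`. -/
theorem exists_strictMono_solution {g : ℝ → ℝ} {P : ℝ} (hg : Continuous g) (hpos : ∀ s, 0 < g s)
    (hP : 0 < P) (hper : Function.Periodic g P) :
    ∃ θ : ℝ → ℝ, StrictMono θ ∧ Function.Surjective θ ∧ (∀ t, HasDerivAt θ (g (θ t)) t) ∧
      ∀ t, θ (t + ∫ s in (0 : ℝ)..P, (g s)⁻¹) = θ t + P := by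
  have hcont : Continuous fun s => (g s)⁻¹ := hg.inv₀ fun s => (hpos s).ne'
  have hint : ∀ a b, IntervalIntegrable (fun s => (g s)⁻¹) volume a b :=
    fun a b => hcont.intervalIntegrable a b
  have hperi : Function.Periodic (fun s => (g s)⁻¹) P := fun s => by simp only [hper s]
  set F : ℝ → ℝ := fun y => ∫ s in (0 : ℝ)..y, (g s)⁻¹ with hF
  have hFd : ∀ y, HasDerivAt F (g y)⁻¹ y := fun y => (hcont.integral_hasStrictDerivAt 0 y).hasDerivAt
  have hFmono : StrictMono F := strictMono_of_deriv_pos fun y => by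
    rw [(hFd y).deriv]; exact inv_pos.2 (hpos y)
  have hFcont : Continuous F := continuous_iff_continuousAt.2 fun y => (hFd y).continuousAt
  have hPpos : 0 < ∫ s in (0 : ℝ)..P, (g s)⁻¹ :=
    intervalIntegral.intervalIntegral_pos_of_pos (hint _ _) (fun s => inv_pos.2 (hpos s)) hP
  have hFsurj : Function.Surjective F := hFcont.surjective
    (hperi.tendsto_atTop_intervalIntegral_of_pos hPpos hP)
    (hperi.tendsto_atBot_intervalIntegral_of_pos hPpos hP)
  let e : ℝ ≃o ℝ := hFmono.orderIsoOfSurjective F hFsurj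
  have he : ∀ y, F (e.symm y) = y := fun y => e.apply_symm_apply y
  refine ⟨e.symm, e.symm.strictMono, e.symm.surjective, fun t => ?_, fun t => ?_⟩
  · simpa using HasDerivAt.of_local_left_inverse e.symm.continuous.continuousAt (hFd (e.symm t))
      (inv_pos.2 (hpos _)).ne' (Eventually.of_forall he)
  · apply hFmono.injective
    rw [he]
    have := hperi.intervalIntegral_add_eq_add 0 (e.symm t) hint
    simp only [zero_add] at this
    simp only [hF, this]
    congr 1
    exact (he t).symm

/-- The angular speed of the undelayed oscillator `x'' - x + x³ = 0` in the coordinate `θ` given by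
`x = √(2 * (1 + c²)) * sin θ`. -/
noncomputable def angularSpeed (c θ : ℝ) : ℝ :=
  Real.sqrt (c ^ 2 + (1 + c ^ 2) * Real.sin θ ^ 2)

theorem radicand_pos {c : ℝ} (hc : 0 < c) (θ : ℝ) :
    0 < c ^ 2 + (1 + c ^ 2) * Real.sin θ ^ 2 := by positivity

theorem angularSpeed_pos {c : ℝ} (hc : 0 < c) (θ : ℝ) : 0 < angularSpeed c θ :=
  Real.sqrt_pos.2 (radicand_pos hc θ)

theorem angularSpeed_sq (c θ : ℝ) :
    angularSpeed c θ ^ 2 = c ^ 2 + (1 + c ^ 2) * Real.sin θ ^ 2 :=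
  Real.sq_sqrt (by positivity)

theorem continuous_angularSpeed : Continuous (Function.uncurry angularSpeed) := by
  unfold angularSpeed Function.uncurry
  fun_prop

theorem angularSpeed_periodic (c : ℝ) : Function.Periodic (angularSpeed c) Real.pi := fun θ => by
  simp [angularSpeed, Real.sin_add_pi]

theorem hasDerivAt_angularSpeed {c : ℝ} (hc : 0 < c) (θ : ℝ) :
    HasDerivAt (angularSpeed c)
      ((1 + c ^ 2) * Real.sin θ * Real.cos θ / angularSpeed c θ) θ := by
  have h := (((Real.hasDerivAt_sin θ).pow 2).const_mul (1 + c ^ 2)).const_add (c ^ 2)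
  refine (h.sqrt (radicand_pos hc θ).ne').congr_deriv ?_
  have := (angularSpeed_pos hc θ).ne'
  change _ / (2 * angularSpeed c θ) = _
  field_simp
  simp only [Nat.cast_ofNat, Nat.add_one_sub_one, pow_one]
  ring

theorem le_angularSpeed (c θ : ℝ) : c ≤ angularSpeed c θ :=
  Real.le_sqrt_of_sq_le (le_add_of_nonneg_right (by positivity))

theorem angularSpeed_le {c s : ℝ} (hc : 0 ≤ c) (hc1 : c ≤ 1) (hs : 0 ≤ s) :
    angularSpeed c s ≤ 2 * (c + s) := by
  have h1 : Real.sin s ^ 2 ≤ s ^ 2 := by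
    rw [sq_le_sq]; exact Real.abs_sin_le_abs
  refine Real.sqrt_le_iff.2 ⟨by positivity, ?_⟩
  have h2 : (1 + c ^ 2) * Real.sin s ^ 2 ≤ 2 * s ^ 2 :=
    mul_le_mul (by nlinarith) h1 (sq_nonneg _) (by norm_num)
  nlinarith [mul_nonneg hc hs]

theorem integral_inv_angularSpeed_le {c : ℝ} (hc : 0 < c) :
    ∫ s in (0 : ℝ)..Real.pi, (angularSpeed c s)⁻¹ ≤ Real.pi / c := by
  have hcont : Continuous fun s => (angularSpeed c s)⁻¹ :=
    (continuous_angularSpeed.uncurry_left c).inv₀ fun s => (angularSpeed_pos hc s).ne'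
  calc _ ≤ ∫ _ in (0 : ℝ)..Real.pi, c⁻¹ :=
        intervalIntegral.integral_mono_on Real.pi_pos.le (hcont.intervalIntegrable _ _)
          (by simp) fun s _ => inv_anti₀ hc (le_angularSpeed c s)
    _ = _ := by simp [div_eq_mul_inv]

theorem le_integral_inv_angularSpeed {c : ℝ} (hc : 0 < c) (hc1 : c ≤ 1) :
    Real.log ((1 + c) / c) / 2 ≤ ∫ s in (0 : ℝ)..Real.pi, (angularSpeed c s)⁻¹ := by
  have hcont : Continuous fun s => (angularSpeed c s)⁻¹ :=
    (continuous_angularSpeed.uncurry_left c).inv₀ fun s => (angularSpeed_pos hc s).ne'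
  calc Real.log ((1 + c) / c) / 2 = ∫ s in (0 : ℝ)..1, 2⁻¹ * (s + c)⁻¹ := by
        rw [intervalIntegral.integral_const_mul,
          intervalIntegral.integral_comp_add_right (fun s : ℝ => s⁻¹),
          integral_inv_of_pos (by linarith) (by linarith), zero_add]
        ring
    _ ≤ ∫ s in (0 : ℝ)..1, (angularSpeed c s)⁻¹ := by
        refine intervalIntegral.integral_mono_on zero_le_one ?_ (hcont.intervalIntegrable _ _) ?_
        · refine ContinuousOn.intervalIntegrable fun s hs => ?_
          rw [uIcc_of_le zero_le_one] at hs
          have : s + c ≠ 0 := by linarith [hs.1]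
          exact ContinuousAt.continuousWithinAt (by fun_prop (disch := assumption))
        · intro s hs
          rw [← mul_inv, add_comm s c]
          exact inv_anti₀ (angularSpeed_pos hc s) (angularSpeed_le hc.le hc1 hs.1)
    _ ≤ _ := intervalIntegral.integral_mono_interval le_rfl zero_le_one
        (by linarith [Real.pi_gt_three])
        (Eventually.of_forall fun s => (inv_pos.2 (angularSpeed_pos hc s)).le)
        (hcont.intervalIntegrable _ _)

/-- Every positive number is the half-period of an outer orbit of `x'' - x + x³ = 0`. -/
theorem exists_integral_inv_angularSpeed_eq {h : ℝ} (hh : 0 < h) :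
    ∃ c, 0 < c ∧ ∫ s in (0 : ℝ)..Real.pi, (angularSpeed c s)⁻¹ = h := by
  have hcont : Continuous fun b : ℝ =>
      ∫ s in (0 : ℝ)..Real.pi, (angularSpeed (Real.exp b) s)⁻¹ := by
    refine intervalIntegral.continuous_parametric_intervalIntegral_of_continuous'
      (f := fun b s => (angularSpeed (Real.exp b) s)⁻¹) ?_ _ _
    exact (continuous_angularSpeed.comp
      (by fun_prop : Continuous fun p : ℝ × ℝ => (Real.exp p.1, p.2))).inv₀
      fun p => (angularSpeed_pos (Real.exp_pos _) _).ne'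
  obtain ⟨b, hb⟩ : h ∈ range fun b : ℝ =>
      ∫ s in (0 : ℝ)..Real.pi, (angularSpeed (Real.exp b) s)⁻¹ := by
    refine mem_range_of_exists_le_of_exists_ge hcont ⟨Real.log (Real.pi / h), ?_⟩ ⟨-(2 * h), ?_⟩
    · have hp : 0 < Real.pi / h := div_pos Real.pi_pos hh
      refine (integral_inv_angularSpeed_le (Real.exp_pos _)).trans_eq ?_
      rw [Real.exp_log hp]
      field_simp
    · refine le_trans ?_ (le_integral_inv_angularSpeed (Real.exp_pos _)
        (Real.exp_le_one_iff.2 (by linarith)))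
      have : 2 * h ≤ Real.log ((1 + Real.exp (-(2 * h))) / Real.exp (-(2 * h))) := by
        rw [Real.le_log_iff_exp_le (by positivity), Real.exp_neg, div_inv_eq_mul]
        have := Real.exp_pos (2 * h)
        field_simp
        linarith
      linarith
  exact ⟨Real.exp b, Real.exp_pos b, hb⟩

/-- for every delay `T > 0` and every odd `n ≥ 1`, the delayed Duffing
equation has a nonconstant periodic solution of minimal period `2T/n`, antiperiodic
with antiperiod `T`, whose amplitude exceeds `√2`. -/
theorem delayedDuffing_odd_solutions (T : ℝ) (hT : 0 < T) (n : ℕ) (hodd : Odd n)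
    (hn : 1 ≤ n) :
    ∃ x : ℝ → ℝ, Differentiable ℝ x ∧ Differentiable ℝ (deriv x) ∧
      (∀ t : ℝ, deriv (deriv x) t + x (t - T) + (x t) ^ 3 = 0) ∧
      IsLeast {q : ℝ | 0 < q ∧ ∀ t : ℝ, x (t + q) = x t} (2 * T / n) ∧
      (∀ t : ℝ, x (t - T) = -x t) ∧
      Real.sqrt 2 < ⨆ t : ℝ, |x t| := by
  have hn0 : (0 : ℝ) < n := by exact_mod_cast hn
  have hh : 0 < T / n := div_pos hT hn0
  obtain ⟨c, hc, hcT⟩ := exists_integral_inv_angularSpeed_eq hh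
  obtain ⟨θ, hθmono, hθsurj, hθ, hθadd⟩ := exists_strictMono_solution
    (continuous_angularSpeed.uncurry_left c) (angularSpeed_pos hc) Real.pi_pos (angularSpeed_periodic c)
  rw [hcT] at hθadd
  set A := Real.sqrt (2 * (1 + c ^ 2)) with hA
  have hA2 : A ^ 2 = 2 * (1 + c ^ 2) := Real.sq_sqrt (by positivity)
  have hAlt : Real.sqrt 2 < A := Real.sqrt_lt_sqrt zero_le_two (by nlinarith [sq_pos_of_pos hc])
  have hApos : 0 < A := (Real.sqrt_nonneg 2).trans_lt hAlt
  set x : ℝ → ℝ := fun t => A * Real.sin (θ t) with hx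
  have hx1 : ∀ t, HasDerivAt x (A * (Real.cos (θ t) * angularSpeed c (θ t))) t := fun t =>
    (hθ t).sin.const_mul A
  have hdx : deriv x = fun t => A * (Real.cos (θ t) * angularSpeed c (θ t)) :=
    funext fun t => (hx1 t).deriv
  have hx2 : ∀ t, HasDerivAt (deriv x) (x t - x t ^ 3) t := fun t => by
    rw [hdx]
    refine (((hθ t).cos.mul
      ((hasDerivAt_angularSpeed hc (θ t)).comp t (hθ t))).const_mul A).congr_deriv ?_
    have h0 := (angularSpeed_pos hc (θ t)).ne'
    have h1 := angularSpeed_sq c (θ t)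
    have h2 := Real.cos_sq' (θ t)
    simp only [hx, Function.comp_apply]
    rw [div_mul_cancel₀ _ h0]
    linear_combination A * Real.sin (θ t) ^ 3 * hA2 - A * Real.sin (θ t) * h1
      + A * (1 + c ^ 2) * Real.sin (θ t) * h2
  have hanti : Function.Antiperiodic x (T / n) := fun t => by
    simp only [hx, hθadd, Real.sin_add_pi]; ring
  have hantiT : Function.Antiperiodic x T := by
    obtain ⟨k, hk⟩ := hodd
    have := hanti.odd_nsmul_antiperiodic k
    rwa [← hk, nsmul_eq_mul, mul_div_cancel₀ _ hn0.ne'] at this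
  obtain ⟨t₀, ht₀⟩ := hθsurj (Real.pi / 2)
  refine ⟨x, fun t => (hx1 t).differentiableAt, fun t => (hx2 t).differentiableAt, fun t => ?_,
    ⟨⟨by positivity, fun t => ?_⟩, ?_⟩, hantiT.sub_eq, hAlt.trans_le ?_⟩
  · rw [(hx2 t).deriv, hantiT.sub_eq]; ring
  · rw [mul_div_assoc]; exact hanti.periodic_two_mul t
  · rintro q ⟨hq, hqx⟩
    by_contra! hlt
    have h1 := hqx t₀
    simp only [hx, ht₀, Real.sin_pi_div_two] at h1
    obtain ⟨k, hk⟩ := Real.sin_eq_one_iff.1 (mul_left_cancel₀ hApos.ne' h1)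
    have h2 : Real.pi / 2 < θ (t₀ + q) := ht₀ ▸ hθmono (by linarith)
    have h3 : θ (t₀ + q) < Real.pi / 2 + Real.pi + Real.pi := by
      rw [← ht₀, ← hθadd, ← hθadd]
      exact hθmono (by rw [mul_div_assoc] at hlt; linarith)
    rw [← hk] at h2 h3
    have hk0 : (0 : ℝ) < k := by
      by_contra! h; nlinarith [Real.pi_pos]
    have hk1 : (k : ℝ) < 1 := by
      by_contra! h; nlinarith [Real.pi_pos]
    have : 0 < k := by exact_mod_cast hk0
    have : k < 1 := by exact_mod_cast hk1
    omega
  · have hbdd : BddAbove (range fun t => |x t|) := by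
      refine ⟨A, ?_⟩
      rintro _ ⟨t, rfl⟩
      simp only [hx, abs_mul, abs_of_pos hApos]
      exact mul_le_of_le_one_right hApos.le (Real.abs_sin_le_one _)
    refine le_trans ?_ (le_ciSup hbdd t₀)
    simp [hx, ht₀, le_abs_self]
end

section
/- For every delay T with 0 < T < 2π and every even natural number n ≥ 2, there exists a twice differentiable function x : ℝ → ℝ such that: x satisfies the delayed Duffing equation x''(t) + x(t − T) + x(t)³ = 0 for all t ∈ ℝ; x is nonconstant periodic with minimal period 2T/n; and x satisfies x(t − T) = x(t) for all t ∈ ℝ. -/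
/-- The angular speed, at phase `s`, of the solution of amplitude `A` of `x'' + x + x³ = 0`
written as `x = A sin φ`. -/
noncomputable def duffingSpeed (A s : ℝ) : ℝ :=
  Real.sqrt (1 + A ^ 2 / 2 * (1 + Real.sin s ^ 2))

/-- The time needed to reach the phase `s` from the phase `0`. -/
noncomputable def duffingTime (A s : ℝ) : ℝ :=
  ∫ u in (0 : ℝ)..s, (duffingSpeed A u)⁻¹

lemma duffingSpeed_arg_pos (A s : ℝ) : 0 < 1 + A ^ 2 / 2 * (1 + Real.sin s ^ 2) := by
  positivity

lemma duffingSpeed_pos (A s : ℝ) : 0 < duffingSpeed A s :=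
  Real.sqrt_pos.2 (duffingSpeed_arg_pos A s)

lemma duffingSpeed_sq (A s : ℝ) :
    duffingSpeed A s ^ 2 = 1 + A ^ 2 / 2 * (1 + Real.sin s ^ 2) :=
  Real.sq_sqrt (duffingSpeed_arg_pos A s).le

lemma continuous_uncurry_duffingSpeed_inv :
    Continuous (Function.uncurry fun A s : ℝ => (duffingSpeed A s)⁻¹) := by
  refine Continuous.inv₀ ?_ fun p => (duffingSpeed_pos p.1 p.2).ne'
  unfold duffingSpeed
  fun_prop

lemma continuous_duffingSpeed_inv (A : ℝ) : Continuous fun s => (duffingSpeed A s)⁻¹ :=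
  continuous_uncurry_duffingSpeed_inv.comp (Continuous.prodMk_right A)

lemma hasDerivAt_duffingSpeed (A s : ℝ) :
    HasDerivAt (duffingSpeed A)
      (A ^ 2 / 2 * (Real.sin s * Real.cos s) / duffingSpeed A s) s := by
  have h := (((((Real.hasDerivAt_sin s).pow 2).const_add 1).const_mul (A ^ 2 / 2)).const_add
    1).sqrt (duffingSpeed_arg_pos A s).ne'
  refine h.congr_deriv ?_
  have := (duffingSpeed_pos A s).ne'
  change _ / (2 * duffingSpeed A s) = _
  field_simp
  norm_num
  ring

lemma hasDerivAt_duffingTime (A s : ℝ) :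
    HasDerivAt (duffingTime A) (duffingSpeed A s)⁻¹ s :=
  intervalIntegral.integral_hasDerivAt_right
    ((continuous_duffingSpeed_inv A).intervalIntegrable _ _)
    ((continuous_duffingSpeed_inv A).stronglyMeasurableAtFilter _ _)
    (continuous_duffingSpeed_inv A).continuousAt

lemma strictMono_duffingTime (A : ℝ) : StrictMono (duffingTime A) :=
  strictMono_of_deriv_pos fun s => by
    rw [(hasDerivAt_duffingTime A s).deriv]
    exact inv_pos.2 (duffingSpeed_pos A s)

lemma duffingTime_zero (A : ℝ) : duffingTime A 0 = 0 := by
  simp [duffingTime]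

lemma duffingTime_add_two_pi (A s : ℝ) :
    duffingTime A (s + 2 * Real.pi) = duffingTime A s + duffingTime A (2 * Real.pi) := by
  have hper : Function.Periodic (fun u => (duffingSpeed A u)⁻¹) (2 * Real.pi) := fun u => by
    simp [duffingSpeed]
  have hi := (continuous_duffingSpeed_inv A).intervalIntegrable (μ := MeasureTheory.volume)
  have h := hper.intervalIntegral_add_eq s 0
  rw [zero_add] at h
  unfold duffingTime
  rw [← h, intervalIntegral.integral_add_adjacent_intervals (hi _ _) (hi _ _)]

lemma le_duffingSpeed_inv (A s : ℝ) : (1 + A ^ 2)⁻¹ ≤ (duffingSpeed A s)⁻¹ := by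
  refine inv_anti₀ (duffingSpeed_pos A s) (Real.sqrt_le_iff.2 ⟨by positivity, ?_⟩)
  nlinarith [Real.sin_sq_le_one s, sq_nonneg A, sq_nonneg (A ^ 2),
    mul_nonneg (sq_nonneg A) (sub_nonneg.2 (Real.sin_sq_le_one s))]

lemma surjective_duffingTime (A : ℝ) : Function.Surjective (duffingTime A) := by
  have hmono : Monotone fun s => duffingTime A s - (1 + A ^ 2)⁻¹ * s := by
    have hd : ∀ s, HasDerivAt (fun s => duffingTime A s - (1 + A ^ 2)⁻¹ * s)
        ((duffingSpeed A s)⁻¹ - (1 + A ^ 2)⁻¹ * 1) s := fun s =>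
      (hasDerivAt_duffingTime A s).sub ((hasDerivAt_id s).const_mul _)
    refine monotone_of_deriv_nonneg (fun s => (hd s).differentiableAt) fun s => ?_
    rw [(hd s).deriv, mul_one]
    exact sub_nonneg.2 (le_duffingSpeed_inv A s)
  have hc : 0 < (1 + A ^ 2)⁻¹ := by positivity
  have hcont : Continuous (duffingTime A) :=
    continuous_iff_continuousAt.2 fun s => (hasDerivAt_duffingTime A s).continuousAt
  refine hcont.surjective ?_ ?_
  · refine Filter.tendsto_atTop_mono' _ ?_ (Filter.tendsto_id.const_mul_atTop hc)
    filter_upwards [Filter.eventually_ge_atTop 0] with s hs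
    have := hmono hs
    simp only [duffingTime_zero] at this
    simp only [id]
    linarith
  · refine Filter.tendsto_atBot_mono' _ ?_ (Filter.tendsto_id.const_mul_atBot hc)
    filter_upwards [Filter.eventually_le_atBot 0] with s hs
    have := hmono hs
    simp only [duffingTime_zero] at this
    simp only [id]
    linarith

/-- Every number in `(0, 2π)` is the period of an orbit of `x'' + x + x³ = 0`. -/
lemma exists_duffingTime_two_pi_eq {P : ℝ} (hP : 0 < P) (hP2 : P < 2 * Real.pi) :
    ∃ A : ℝ, 0 < A ∧ duffingTime A (2 * Real.pi) = P := by
  have hpi := Real.pi_pos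
  have hcont : Continuous fun A => duffingTime A (2 * Real.pi) :=
    intervalIntegral.continuous_parametric_intervalIntegral_of_continuous'
      continuous_uncurry_duffingSpeed_inv 0 (2 * Real.pi)
  have h0 : duffingTime 0 (2 * Real.pi) = 2 * Real.pi := by
    simp [duffingTime, duffingSpeed]
  set B : ℝ := 2 * (2 * Real.pi / P) with hB
  have hBpos : 0 < B := by positivity
  have hBle : duffingTime B (2 * Real.pi) ≤ P := by
    have hle : ∀ s, (duffingSpeed B s)⁻¹ ≤ P / (2 * Real.pi) := fun s => by
      rw [← inv_div]
      refine inv_anti₀ (by positivity) (Real.le_sqrt_of_sq_le ?_)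
      have h1 : 2 * Real.pi / P = B / 2 := by rw [hB]; ring
      rw [h1]
      nlinarith [sq_nonneg B, mul_nonneg (sq_nonneg B) (sq_nonneg (Real.sin s))]
    have h := intervalIntegral.integral_mono (a := 0) (b := 2 * Real.pi)
      (μ := MeasureTheory.volume) (by positivity)
      ((continuous_duffingSpeed_inv B).intervalIntegrable _ _)
      (continuous_const.intervalIntegrable _ _) hle
    rw [intervalIntegral.integral_const, smul_eq_mul, sub_zero,
      mul_div_cancel₀ _ (by positivity)] at h
    exact h
  obtain ⟨A, hA, hAP⟩ := intermediate_value_Icc' hBpos.le hcont.continuousOn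
    ⟨hBle, by simpa only [h0] using hP2.le⟩
  refine ⟨A, lt_of_le_of_ne hA.1 ?_, hAP⟩
  rintro rfl
  simp only [h0] at hAP
  exact hP2.ne' hAP

/-- The Duffing equation `x'' + x + x³ = 0` has solutions of every minimal period in `(0, 2π)`. -/
lemma exists_duffing_solution {P : ℝ} (hP : 0 < P) (hP2 : P < 2 * Real.pi) :
    ∃ x : ℝ → ℝ, Differentiable ℝ x ∧ Differentiable ℝ (deriv x) ∧
      (∀ t : ℝ, deriv (deriv x) t + x t + (x t) ^ 3 = 0) ∧
      IsLeast {q : ℝ | 0 < q ∧ ∀ t : ℝ, x (t + q) = x t} P := by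
  obtain ⟨A, hA, hAP⟩ := exists_duffingTime_two_pi_eq hP hP2
  let e := (strictMono_duffingTime A).orderIsoOfSurjective _ (surjective_duffingTime A)
  let φ : ℝ → ℝ := fun t => e.symm t
  have hτφ : ∀ t, duffingTime A (φ t) = t := e.apply_symm_apply
  have hφτ : ∀ s, φ (duffingTime A s) = s := e.symm_apply_apply
  have hφmono : StrictMono φ := e.symm.strictMono
  have hφ : ∀ t, HasDerivAt φ (duffingSpeed A (φ t)) t := fun t => by
    have h := (hasDerivAt_duffingTime A (φ t)).of_local_left_inverse
      e.symm.continuous.continuousAt (inv_ne_zero (duffingSpeed_pos A _).ne')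
      (Filter.Eventually.of_forall hτφ)
    rwa [inv_inv] at h
  have hφ0 : φ 0 = 0 := by simpa only [duffingTime_zero] using hφτ 0
  have hφP : φ P = 2 * Real.pi := by rw [← hAP, hφτ]
  have hφadd : ∀ t, φ (t + P) = φ t + 2 * Real.pi := fun t => by
    rw [← hφτ (φ t + 2 * Real.pi), duffingTime_add_two_pi, hτφ, hAP]
  have hx : ∀ t, HasDerivAt (fun t => A * Real.sin (φ t))
      (A * (Real.cos (φ t) * duffingSpeed A (φ t))) t := fun t => (hφ t).sin.const_mul A
  have hx' : deriv (fun t => A * Real.sin (φ t)) =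
      fun t => A * (Real.cos (φ t) * duffingSpeed A (φ t)) := funext fun t => (hx t).deriv
  have hxx : ∀ t, HasDerivAt (deriv fun t => A * Real.sin (φ t))
      (-(A * Real.sin (φ t)) - (A * Real.sin (φ t)) ^ 3) t := fun t => by
    rw [hx']
    refine ((((hφ t).cos).mul ((hasDerivAt_duffingSpeed A (φ t)).comp t (hφ t))).const_mul
      A).congr_deriv ?_
    have hne := (duffingSpeed_pos A (φ t)).ne'
    rw [div_mul_cancel₀ _ hne]
    simp only [Function.comp_apply]
    linear_combination (-A * Real.sin (φ t)) * duffingSpeed_sq A (φ t) +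
      A ^ 3 / 2 * Real.sin (φ t) * Real.sin_sq_add_cos_sq (φ t)
  refine ⟨fun t => A * Real.sin (φ t), fun t => (hx t).differentiableAt,
    fun t => (hxx t).differentiableAt, fun t => ?_, ⟨hP, fun t => ?_⟩, ?_⟩
  · rw [(hxx t).deriv]
    ring
  · simp only [hφadd, Real.sin_add_two_pi]
  · rintro q ⟨hq, hper⟩
    have hsin : Real.sin (φ q) = 0 := by
      have h := hper 0
      simp only [zero_add, hφ0, Real.sin_zero, mul_zero] at h
      exact (mul_eq_zero.1 h).resolve_left hA.ne'
    have hspeed : duffingSpeed A (φ q) = duffingSpeed A 0 := by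
      simp [duffingSpeed, hsin]
    have hcos : Real.cos (φ q) = 1 := by
      have h : deriv (fun t => A * Real.sin (φ t)) (0 + q) =
          deriv (fun t => A * Real.sin (φ t)) 0 := by
        rw [← deriv_comp_add_const]
        exact congrArg (fun f => deriv f 0) (funext hper)
      rw [hx'] at h
      simp only [zero_add, hφ0, Real.cos_zero, hspeed] at h
      exact mul_right_cancel₀ (duffingSpeed_pos A 0).ne' (mul_left_cancel₀ hA.ne' h)
    obtain ⟨k, hk⟩ := (Real.cos_eq_one_iff _).1 hcos
    have hφq : 0 < φ q := hφ0 ▸ hφmono hq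
    have hk0 : 0 < k := by
      rw [← hk] at hφq
      exact_mod_cast pos_of_mul_pos_left hφq (by positivity)
    refine hφmono.le_iff_le.1 ?_
    rw [hφP, ← hk]
    have : (1 : ℝ) ≤ k := by exact_mod_cast hk0
    nlinarith [Real.pi_pos]


/-- for every delay `0 < T < 2π` and every even `n ≥ 2`, the delayed
Duffing equation has a nonconstant periodic solution of minimal period `2T/n`, which
is also periodic with (non-minimal) period `T`. -/
theorem delayedDuffing_even_solutions (T : ℝ) (hT : 0 < T) (hT2 : T < 2 * Real.pi)
    (n : ℕ) (heven : Even n) (hn : 2 ≤ n) :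
    ∃ x : ℝ → ℝ, Differentiable ℝ x ∧ Differentiable ℝ (deriv x) ∧
      (∀ t : ℝ, deriv (deriv x) t + x (t - T) + (x t) ^ 3 = 0) ∧
      IsLeast {q : ℝ | 0 < q ∧ ∀ t : ℝ, x (t + q) = x t} (2 * T / n) ∧
      (∀ t : ℝ, x (t - T) = x t) := by
  obtain ⟨m, rfl⟩ := heven
  have hm : (1 : ℝ) ≤ m := by exact_mod_cast (by omega : 1 ≤ m)
  have hP : 2 * T / ((m + m : ℕ) : ℝ) = T / m := by
    push_cast
    field_simp
    ring
  rw [hP]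
  obtain ⟨x, hx, hx', hode, hleast⟩ := exists_duffing_solution (P := T / m) (by positivity)
    ((div_le_self hT.le hm).trans_lt hT2)
  have hdelay : ∀ t, x (t - T) = x t := fun t => by
    have h := (Function.Periodic.nat_mul (f := x) hleast.1.2 m).sub_eq t
    rwa [mul_div_cancel₀ _ (by positivity)] at h
  exact ⟨x, hx, hx', fun t => by rw [hdelay]; exact hode t, hleast, hdelay⟩
end

section
/- Let x, y : ℝ → ℝ be twice differentiable, nonconstant solutions of the single-well Duffing equation x''(t) + x(t) + x(t)³ = 0 with the same minimal period p > 0. Then there exists θ ∈ ℝ such that y(t) = x(t + θ) for all t ∈ ℝ. -/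
open Real Set Filter Topology

namespace Duffing

/-- The bound on the Lipschitz constant of the Duffing vector field on a ball of radius `R`. -/
theorem lipschitzOnWith_vectorField (R : ℝ) :
    LipschitzOnWith (1 + 3 * R ^ 2).toNNReal
      (fun z : ℝ × ℝ => (z.2, -z.1 - z.1 ^ 3)) {z | |z.1| ≤ R} := by
  refine LipschitzOnWith.of_dist_le_mul fun z hz w hw => ?_
  rw [Real.coe_toNNReal _ (by positivity), Prod.dist_eq]
  have h1 : dist z.1 w.1 ≤ dist z w := le_max_left _ _
  have h2 : dist z.2 w.2 ≤ dist z w := le_max_right _ _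
  have h0 : 0 ≤ dist z w := dist_nonneg
  refine max_le (by nlinarith [mul_nonneg (sq_nonneg R) h0]) ?_
  have hz' := abs_le.1 (show |z.1| ≤ R from hz)
  have hw' := abs_le.1 (show |w.1| ≤ R from hw)
  have hq : z.1 ^ 2 + z.1 * w.1 + w.1 ^ 2 ≤ 3 * R ^ 2 := by nlinarith
  have hq0 : 0 ≤ z.1 ^ 2 + z.1 * w.1 + w.1 ^ 2 := by nlinarith [sq_nonneg (z.1 + w.1)]
  have key : dist (-z.1 - z.1 ^ 3) (-w.1 - w.1 ^ 3)
      = (1 + (z.1 ^ 2 + z.1 * w.1 + w.1 ^ 2)) * dist z.1 w.1 := by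
    rw [Real.dist_eq, Real.dist_eq,
      show -z.1 - z.1 ^ 3 - (-w.1 - w.1 ^ 3)
        = -((1 + (z.1 ^ 2 + z.1 * w.1 + w.1 ^ 2)) * (z.1 - w.1)) by ring,
      abs_neg, abs_mul, abs_of_nonneg (by linarith)]
  calc dist (-z.1 - z.1 ^ 3) (-w.1 - w.1 ^ 3)
      = (1 + (z.1 ^ 2 + z.1 * w.1 + w.1 ^ 2)) * dist z.1 w.1 := key
    _ ≤ (1 + 3 * R ^ 2) * dist z w := by gcongr

/-- `x` solves the Duffing equation with velocity `u`. -/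
structure IsSolution (x u : ℝ → ℝ) : Prop where
  hasDerivAt_fst : ∀ t, HasDerivAt x (u t) t
  hasDerivAt_snd : ∀ t, HasDerivAt u (-x t - x t ^ 3) t

namespace IsSolution

variable {x u y v : ℝ → ℝ}

theorem energy_eq (h : IsSolution x u) (t : ℝ) :
    u t ^ 2 + x t ^ 2 + x t ^ 4 / 2 = u 0 ^ 2 + x 0 ^ 2 + x 0 ^ 4 / 2 := by
  have hd : ∀ s, HasDerivAt (fun s => u s ^ 2 + x s ^ 2 + x s ^ 4 / 2) 0 s := fun s => by
    have := (((h.hasDerivAt_snd s).pow 2).add ((h.hasDerivAt_fst s).pow 2)).add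
      (((h.hasDerivAt_fst s).pow 4).div_const 2)
    refine this.congr_deriv ?_
    push_cast
    ring
  exact is_const_of_deriv_eq_zero (fun s => (hd s).differentiableAt) (fun s => (hd s).deriv) t 0

theorem exists_abs_le (h : IsSolution x u) : ∃ R, ∀ t, |x t| ≤ R :=
  ⟨_, fun t => Real.abs_le_sqrt (y := u 0 ^ 2 + x 0 ^ 2 + x 0 ^ 4 / 2) <| by
    rw [← h.energy_eq t]; nlinarith [sq_nonneg (u t), sq_nonneg (x t ^ 2)]⟩

theorem ext (hx : IsSolution x u) (hy : IsSolution y v) (h0 : x 0 = y 0) (h1 : u 0 = v 0) :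
    x = y := by
  obtain ⟨R, hR⟩ := hx.exists_abs_le
  obtain ⟨S, hS⟩ := hy.exists_abs_le
  have : (fun t => (x t, u t)) = fun t => (y t, v t) :=
    ODE_solution_unique_univ (t₀ := 0) (s := fun _ => {z : ℝ × ℝ | |z.1| ≤ max R S})
      (v := fun _ z => (z.2, -z.1 - z.1 ^ 3))
      (fun _ => lipschitzOnWith_vectorField (max R S))
      (fun t => ⟨(hx.hasDerivAt_fst t).prodMk (hx.hasDerivAt_snd t), (hR t).trans (le_max_left _ _)⟩)
      (fun t => ⟨(hy.hasDerivAt_fst t).prodMk (hy.hasDerivAt_snd t), (hS t).trans (le_max_right _ _)⟩)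
      (by simp [h0, h1])
  funext t
  exact congrArg Prod.fst (congrFun this t)

end IsSolution

/-- The angular speed at phase `s` of the Duffing oscillation of squared amplitude `a`. -/
noncomputable def speed (a s : ℝ) : ℝ := √(1 + a * (1 + sin s ^ 2) / 2)

variable {a b : ℝ}

theorem speed_pos (ha : 0 ≤ a) (s : ℝ) : 0 < speed a s := Real.sqrt_pos.2 (by positivity)

theorem sq_speed (ha : 0 ≤ a) (s : ℝ) : speed a s ^ 2 = 1 + a * (1 + sin s ^ 2) / 2 :=
  Real.sq_sqrt (by positivity)

theorem continuous_speed (a : ℝ) : Continuous (speed a) := by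
  unfold speed
  fun_prop

theorem speed_periodic (a : ℝ) : Function.Periodic (speed a) (2 * π) := fun s => by
  simp [speed]

theorem speed_lt_speed (ha : 0 ≤ a) (hab : a < b) (s : ℝ) : speed a s < speed b s :=
  Real.sqrt_lt_sqrt (by positivity) (by gcongr)

theorem continuous_inv_speed (ha : 0 ≤ a) : Continuous fun s => (speed a s)⁻¹ :=
  (continuous_speed a).inv₀ fun s => (speed_pos ha s).ne'

/-- The time needed to travel from phase `0` to phase `θ`. -/
noncomputable def phaseTime (a θ : ℝ) : ℝ := ∫ s in (0 : ℝ)..θ, (speed a s)⁻¹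

theorem hasDerivAt_phaseTime (ha : 0 ≤ a) (θ : ℝ) :
    HasDerivAt (phaseTime a) (speed a θ)⁻¹ θ :=
  (continuous_inv_speed ha).integral_hasStrictDerivAt 0 θ |>.hasDerivAt

theorem strictMono_phaseTime (ha : 0 ≤ a) : StrictMono (phaseTime a) :=
  strictMono_of_hasDerivAt_pos (hasDerivAt_phaseTime ha) fun s => inv_pos.2 (speed_pos ha s)

theorem monotone_phaseTime_sub (ha : 0 ≤ a) :
    Monotone fun θ => phaseTime a θ - (√(1 + a))⁻¹ * θ := by
  have hd : ∀ θ, HasDerivAt (fun θ => phaseTime a θ - (√(1 + a))⁻¹ * θ)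
      ((speed a θ)⁻¹ - (√(1 + a))⁻¹ * 1) θ := fun θ =>
    (hasDerivAt_phaseTime ha θ).sub ((hasDerivAt_id θ).const_mul _)
  refine monotone_of_hasDerivAt_nonneg hd fun θ => ?_
  have hle : speed a θ ≤ √(1 + a) :=
    Real.sqrt_le_sqrt (by nlinarith [Real.sin_sq_le_one θ])
  have := inv_anti₀ (speed_pos ha θ) hle
  simpa using this

theorem surjective_phaseTime (ha : 0 ≤ a) : Function.Surjective (phaseTime a) := by
  have hc : Continuous (phaseTime a) :=
    continuous_iff_continuousAt.2 fun θ => (hasDerivAt_phaseTime ha θ).continuousAt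
  have hpos : 0 < (√(1 + a))⁻¹ := by positivity
  have h0 : phaseTime a 0 = 0 := by simp [phaseTime]
  refine hc.surjective
    (tendsto_atTop_mono' _ ?_ (tendsto_id.const_mul_atTop hpos))
    (tendsto_atBot_mono' _ ?_ (tendsto_id.const_mul_atBot hpos))
  · filter_upwards [eventually_ge_atTop 0] with θ hθ
    have := monotone_phaseTime_sub ha hθ
    simp only [h0, mul_zero, sub_zero] at this
    simpa using this
  · filter_upwards [eventually_le_atBot 0] with θ hθ
    have := monotone_phaseTime_sub ha hθ
    simp only [h0, mul_zero, sub_zero] at this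
    simpa using this

/-- The time change between phase and time. -/
noncomputable def phaseTimeIso (ha : 0 ≤ a) : ℝ ≃o ℝ :=
  (strictMono_phaseTime ha).orderIsoOfSurjective _ (surjective_phaseTime ha)

/-- The phase reached at time `t`, starting from phase `0`. -/
noncomputable def phase (ha : 0 ≤ a) (t : ℝ) : ℝ := (phaseTimeIso ha).symm t

theorem phaseTime_phase (ha : 0 ≤ a) (t : ℝ) : phaseTime a (phase ha t) = t :=
  (phaseTimeIso ha).apply_symm_apply t

theorem phase_phaseTime (ha : 0 ≤ a) (θ : ℝ) : phase ha (phaseTime a θ) = θ :=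
  (phaseTimeIso ha).symm_apply_apply θ

theorem hasDerivAt_phase (ha : 0 ≤ a) (t : ℝ) :
    HasDerivAt (phase ha) (speed a (phase ha t)) t := by
  have := HasDerivAt.of_local_left_inverse (g := phase ha) (a := t)
    (phaseTimeIso ha).symm.continuous.continuousAt (hasDerivAt_phaseTime ha _)
    (inv_pos.2 (speed_pos ha _)).ne' (Eventually.of_forall (phaseTime_phase ha))
  simpa using this

theorem isSolution_sin_phase (ha : 0 ≤ a) (c : ℝ) :
    IsSolution (fun t => √a * sin (phase ha (t + c)))
      fun t => √a * (cos (phase ha (t + c)) * speed a (phase ha (t + c))) := by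
  have hφ : ∀ t, HasDerivAt (fun t => phase ha (t + c)) (speed a (phase ha (t + c))) t :=
    fun t => (hasDerivAt_phase ha (t + c)).comp_add_const t c
  have hspeed : ∀ s, HasDerivAt (speed a) (a * (sin s * cos s) / (2 * speed a s)) s := fun s => by
    have hne : 1 + a * (1 + sin s ^ 2) / 2 ≠ 0 := by positivity
    have h := (((((hasDerivAt_sin s).fun_pow 2).const_add 1).const_mul a).div_const 2).const_add 1
    refine (h.sqrt hne).congr_deriv ?_
    simp only [speed]
    push_cast
    ring
  refine ⟨fun t => (hφ t).sin.const_mul _, fun t => ?_⟩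
  have h := ((hφ t).cos.mul ((hspeed _).comp t (hφ t))).const_mul √a
  refine h.congr_deriv ?_
  have hg := (speed_pos ha (phase ha (t + c))).ne'
  have hg2 := sq_speed ha (phase ha (t + c))
  have hA := Real.sq_sqrt ha
  have hsc := Real.sin_sq_add_cos_sq (phase ha (t + c))
  simp only [Function.comp_apply]
  generalize phase ha (t + c) = θ at *
  have e : a * (sin θ * cos θ) / (2 * speed a θ) * speed a θ = a * (sin θ * cos θ) / 2 := by
    field_simp
  rw [e, mul_pow, show √a ^ 3 = √a * a by rw [pow_succ, hA, mul_comm]]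
  linear_combination (-√a * sin θ) * hg2 + √a * sin θ * a / 2 * hsc

theorem phaseTime_add_two_pi (ha : 0 ≤ a) (θ : ℝ) :
    phaseTime a (θ + 2 * π) = phaseTime a θ + phaseTime a (2 * π) := by
  have := (speed_periodic a).comp (fun z => z⁻¹) |>.intervalIntegral_add_eq_add 0 θ
    fun _ _ => (continuous_inv_speed ha).intervalIntegrable _ _
  simpa [phaseTime] using this

theorem phaseTime_add_int_mul (ha : 0 ≤ a) (θ : ℝ) (k : ℤ) :
    phaseTime a (θ + k * (2 * π)) = phaseTime a θ + k * phaseTime a (2 * π) := by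
  induction k using Int.induction_on with
  | zero => simp
  | succ n ih =>
    push_cast at ih ⊢
    rw [add_one_mul, ← add_assoc, phaseTime_add_two_pi ha, ih]
    ring
  | pred n ih =>
    have := phaseTime_add_two_pi ha (θ + (-(n : ℝ) - 1) * (2 * π))
    rw [show θ + (-(n : ℝ) - 1) * (2 * π) + 2 * π = θ + -(n : ℝ) * (2 * π) by ring] at this
    push_cast at ih ⊢
    linarith

theorem phase_add_phaseTime_two_pi (ha : 0 ≤ a) (t : ℝ) :
    phase ha (t + phaseTime a (2 * π)) = phase ha t + 2 * π := by
  apply (strictMono_phaseTime ha).injective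
  rw [phaseTime_phase, phaseTime_add_two_pi ha, phaseTime_phase]

theorem phaseTime_two_pi_pos (ha : 0 ≤ a) : 0 < phaseTime a (2 * π) := by
  have := strictMono_phaseTime ha (show (0 : ℝ) < 2 * π by positivity)
  simpa [phaseTime] using this

theorem isLeast_period_sin_phase (ha : 0 < a) (c : ℝ) :
    IsLeast {q : ℝ | 0 < q ∧ ∀ t : ℝ,
      √a * sin (phase ha.le (t + q + c)) = √a * sin (phase ha.le (t + c))}
      (phaseTime a (2 * π)) := by
  refine ⟨⟨phaseTime_two_pi_pos ha.le, fun t => ?_⟩, fun q ⟨hq, hqt⟩ => ?_⟩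
  · rw [add_right_comm, phase_add_phaseTime_two_pi, sin_add_two_pi]
  · have h := mul_left_cancel₀ (Real.sqrt_pos.2 ha).ne' (hqt (phaseTime a (π / 2) - c))
    rw [sub_add_cancel, phase_phaseTime, sin_pi_div_two, sub_add_eq_add_sub, sub_add_cancel,
      Real.sin_eq_one_iff] at h
    obtain ⟨k, hk⟩ := h
    have hk' := congrArg (phaseTime a) hk
    rw [phaseTime_phase, phaseTime_add_int_mul ha.le] at hk'
    have hP := phaseTime_two_pi_pos ha.le
    have hkq : k * phaseTime a (2 * π) = q := by linarith
    have hk0 : (0 : ℝ) < k := by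
      by_contra! hneg
      nlinarith
    have hk1 : (1 : ℝ) ≤ k := by exact_mod_cast hk0
    nlinarith

theorem phaseTime_two_pi_lt (ha : 0 ≤ a) (hab : a < b) :
    phaseTime b (2 * π) < phaseTime a (2 * π) := by
  have h : ∀ s, (speed b s)⁻¹ < (speed a s)⁻¹ := fun s =>
    inv_strictAnti₀ (speed_pos ha s) (speed_lt_speed ha hab s)
  exact intervalIntegral.integral_lt_integral_of_continuousOn_of_le_of_exists_lt two_pi_pos
    (continuous_inv_speed (ha.trans hab.le)).continuousOn (continuous_inv_speed ha).continuousOn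
    (fun s _ => (h s).le) ⟨0, ⟨le_rfl, two_pi_pos.le⟩, h 0⟩

theorem exists_cos_sin_eq {r s : ℝ} (h : r ^ 2 + s ^ 2 = 1) :
    ∃ θ : ℝ, cos θ = r ∧ sin θ = s := by
  have hn : ‖(⟨r, s⟩ : ℂ)‖ = 1 := by
    rw [Complex.norm_def, Complex.normSq_mk, ← sq, ← sq, h, Real.sqrt_one]
  refine ⟨Complex.arg ⟨r, s⟩, ?_, ?_⟩
  · simpa [hn] using Complex.norm_mul_cos_arg ⟨r, s⟩
  · simpa [hn] using Complex.norm_mul_sin_arg ⟨r, s⟩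

/-- Every nonzero point of the phase plane lies on one of the curves traced out by
`isSolution_sin_phase`. -/
theorem exists_amplitude_phase {r s : ℝ} (h : 0 < s ^ 2 + r ^ 2 + r ^ 4 / 2) :
    ∃ a θ : ℝ, 0 < a ∧ √a * sin θ = r ∧ √a * (cos θ * speed a θ) = s := by
  set E := s ^ 2 + r ^ 2 + r ^ 4 / 2 with hE
  have hq : √(1 + 2 * E) ^ 2 = 1 + 2 * E := Real.sq_sqrt (by linarith)
  have hq1 : 1 < √(1 + 2 * E) := Real.lt_sqrt_of_sq_lt (by linarith)
  obtain ⟨a, haE⟩ : ∃ a, a = √(1 + 2 * E) - 1 := ⟨_, rfl⟩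
  have ha : 0 < a := by linarith
  have hen : a + a ^ 2 / 2 = E := by rw [haE]; linear_combination hq / 2
  have hA : √a ^ 2 = a := Real.sq_sqrt ha.le
  have hA0 : √a ≠ 0 := (Real.sqrt_pos.2 ha).ne'
  have hG : √(1 + (a + r ^ 2) / 2) ^ 2 = 1 + (a + r ^ 2) / 2 := Real.sq_sqrt (by positivity)
  have hG0 : √(1 + (a + r ^ 2) / 2) ≠ 0 := (Real.sqrt_pos.2 (by positivity)).ne'
  obtain ⟨θ, hc, hs⟩ := exists_cos_sin_eq
    (r := s / (√a * √(1 + (a + r ^ 2) / 2))) (s := r / √a) (by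
      rw [div_pow, div_pow, mul_pow, hA, hG]
      field_simp
      rw [hE] at hen
      linear_combination (-2) * hen)
  have hr : √a * sin θ = r := by rw [hs]; field_simp
  refine ⟨a, θ, ha, hr, ?_⟩
  have hsp : speed a θ = √(1 + (a + r ^ 2) / 2) := by
    rw [speed, ← hr, mul_pow, hA]
    ring_nf
  rw [hsp, hc]
  field_simp

theorem IsSolution.exists_eq_sin_phase {x u : ℝ → ℝ} (h : IsSolution x u)
    (hnc : ¬ ∃ c : ℝ, ∀ t : ℝ, x t = c) :
    ∃ (a : ℝ) (ha : 0 < a) (c : ℝ), x = fun t => √a * sin (phase ha.le (t + c)) := by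
  have hE : 0 < u 0 ^ 2 + x 0 ^ 2 + x 0 ^ 4 / 2 := by
    by_contra! hle
    refine hnc ⟨0, fun t => ?_⟩
    have := h.energy_eq t
    have h4 : 0 ≤ x t ^ 4 := by positivity
    nlinarith [sq_nonneg (u t), sq_nonneg (x t)]
  obtain ⟨a, θ, ha, hr, hs⟩ := exists_amplitude_phase hE
  refine ⟨a, ha, phaseTime a θ, h.ext (isSolution_sin_phase ha.le _) ?_ ?_⟩
  · simp [phase_phaseTime, hr]
  · simp [phase_phaseTime, hs]

theorem isSolution_of_deriv {x : ℝ → ℝ} (hx : Differentiable ℝ x)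
    (hx' : Differentiable ℝ (deriv x))
    (hode : ∀ t : ℝ, deriv (deriv x) t + x t + (x t) ^ 3 = 0) : IsSolution x (deriv x) :=
  ⟨fun t => (hx t).hasDerivAt, fun t => (hx' t).hasDerivAt.congr_deriv (by linarith [hode t])⟩

end Duffing


/-- two nonconstant solutions of the single-well Duffing equation
with the same minimal period agree up to a time shift. -/
theorem singleWell_same_period_time_shift
    (x y : ℝ → ℝ)
    (hx : Differentiable ℝ x) (hx' : Differentiable ℝ (deriv x))
    (hy : Differentiable ℝ y) (hy' : Differentiable ℝ (deriv y))
    (hodex : ∀ t : ℝ, deriv (deriv x) t + x t + (x t) ^ 3 = 0)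
    (hodey : ∀ t : ℝ, deriv (deriv y) t + y t + (y t) ^ 3 = 0)
    (hncx : ¬ ∃ c : ℝ, ∀ t : ℝ, x t = c)
    (hncy : ¬ ∃ c : ℝ, ∀ t : ℝ, y t = c)
    (p : ℝ) (hp : 0 < p)
    (hpx : IsLeast {q : ℝ | 0 < q ∧ ∀ t : ℝ, x (t + q) = x t} p)
    (hpy : IsLeast {q : ℝ | 0 < q ∧ ∀ t : ℝ, y (t + q) = y t} p) :
    ∃ θ : ℝ, ∀ t : ℝ, y t = x (t + θ) := by
  obtain ⟨a, ha, c, rfl⟩ := (Duffing.isSolution_of_deriv hx hx' hodex).exists_eq_sin_phase hncx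
  obtain ⟨b, hb, d, rfl⟩ := (Duffing.isSolution_of_deriv hy hy' hodey).exists_eq_sin_phase hncy
  have hP : Duffing.phaseTime a (2 * π) = Duffing.phaseTime b (2 * π) :=
    ((Duffing.isLeast_period_sin_phase ha c).unique hpx).trans
      ((Duffing.isLeast_period_sin_phase hb d).unique hpy).symm
  obtain rfl : a = b := by
    rcases lt_trichotomy a b with h | h | h
    · exact absurd hP (Duffing.phaseTime_two_pi_lt ha.le h).ne'
    · exact h
    · exact absurd hP (Duffing.phaseTime_two_pi_lt hb.le h).ne
  exact ⟨d - c, fun t => by simp [add_assoc]⟩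
end

section
/- Define P₊ : (0, ∞) → ℝ by P₊(A) = 4·∫₀^A du / √((A² − u²)·(1 + A²/2 + u²/2)). Then lim_{A → ∞} A·P₊(A) = Γ(1/4)² / √π, where Γ denotes the Euler Gamma function. -/
open intervalIntegral Filter

open MeasureTheory Set in
theorem integrableOn_rpow_mul_one_sub_rpow_and_integral_eq {a b : ℝ} (ha : 0 < a) (hb : 0 < b) :
    IntegrableOn (fun x : ℝ => x ^ (a - 1) * (1 - x) ^ (b - 1)) (Ioo 0 1) ∧
      ∫ x in Ioo (0 : ℝ) 1, x ^ (a - 1) * (1 - x) ^ (b - 1) =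
        Real.Gamma a * Real.Gamma b / Real.Gamma (a + b) := by
  have hcongr : EqOn (fun x : ℝ => (x : ℂ) ^ ((a : ℂ) - 1) * (1 - (x : ℂ)) ^ ((b : ℂ) - 1))
      (fun x : ℝ => ((x ^ (a - 1) * (1 - x) ^ (b - 1) : ℝ) : ℂ)) (Ioo 0 1) := by
    intro x hx
    have h1 : (0 : ℝ) ≤ 1 - x := by linarith [hx.2]
    push_cast [Complex.ofReal_cpow hx.1.le, Complex.ofReal_cpow h1]
    rfl
  have hInt := Complex.betaIntegral_convergent (u := a) (v := b) (by simpa) (by simpa)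
  rw [intervalIntegrable_iff_integrableOn_Ioo_of_le zero_le_one] at hInt
  refine ⟨(hInt.congr_fun hcongr measurableSet_Ioo).re, ?_⟩
  change _ = ProbabilityTheory.beta a b
  rw [ProbabilityTheory.beta_eq_betaIntegralReal a b ha hb, Complex.betaIntegral,
    integral_of_le zero_le_one, integral_Ioc_eq_integral_Ioo,
    setIntegral_congr_fun measurableSet_Ioo hcongr, integral_complex_ofReal, Complex.ofReal_re]

theorem Real.Gamma_one_fourth_mul_Gamma_half_div :
    Real.Gamma (1 / 4) * Real.Gamma (1 / 2) / Real.Gamma (1 / 4 + 1 / 2) =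
      Real.Gamma (1 / 4) ^ 2 / (√2 * √Real.pi) := by
  have hrefl := Real.Gamma_mul_Gamma_one_sub (1 / 4)
  rw [show Real.pi * (1 / 4) = Real.pi / 4 by ring, Real.sin_pi_div_four,
    show (1 : ℝ) - 1 / 4 = 1 / 4 + 1 / 2 by norm_num] at hrefl
  have h3 : Real.Gamma (1 / 4 + 1 / 2) ≠ 0 := (Real.Gamma_pos_of_pos (by norm_num)).ne'
  have hpi : √Real.pi ≠ 0 := by positivity
  have hpi2 : √Real.pi * √Real.pi = Real.pi := Real.mul_self_sqrt Real.pi_pos.le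
  have h2 : √(2 : ℝ) * √2 = 2 := Real.mul_self_sqrt zero_le_two
  rw [Real.Gamma_one_half_eq]
  generalize Real.Gamma (1 / 4 + 1 / 2) = c at hrefl h3 ⊢
  field_simp at hrefl ⊢
  linear_combination √2 * hpi2 - √2 / 2 * hrefl + Real.Gamma (1 / 4) * c / 2 * h2

open MeasureTheory Set in
theorem integrableOn_one_div_sqrt_one_sub_pow_four_and_integral_eq :
    IntegrableOn (fun s : ℝ => 1 / √(1 - s ^ 4)) (Ioo 0 1) ∧
      ∫ s in Ioo (0 : ℝ) 1, 1 / √(1 - s ^ 4) =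
        Real.Gamma (1 / 4) ^ 2 / (4 * √2 * √Real.pi) := by
  have himage : (fun s : ℝ => s ^ 4) '' Ioo 0 1 = Ioo 0 1 := by
    ext y
    constructor
    · rintro ⟨s, hs, rfl⟩
      exact ⟨pow_pos hs.1 4, pow_lt_one₀ hs.1.le hs.2 (by norm_num)⟩
    · intro hy
      refine ⟨y ^ (1 / 4 : ℝ), ⟨Real.rpow_pos_of_pos hy.1 _,
        Real.rpow_lt_one hy.1.le hy.2 (by norm_num)⟩, ?_⟩
      simp only
      rw [← Real.rpow_natCast, ← Real.rpow_mul hy.1.le]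
      norm_num
  have hderiv : ∀ s ∈ Ioo (0 : ℝ) 1,
      HasDerivWithinAt (fun s : ℝ => s ^ 4) (4 * s ^ 3) (Ioo 0 1) s := fun s _ => by
    simpa using (hasDerivAt_pow 4 s).hasDerivWithinAt
  have hinj : InjOn (fun s : ℝ => s ^ 4) (Ioo 0 1) := fun x hx y hy hxy =>
    (pow_left_inj₀ hx.1.le hy.1.le (by norm_num)).1 hxy
  have hcongr : EqOn (fun s : ℝ => |4 * s ^ 3| •
      ((s ^ 4) ^ ((1 / 4 : ℝ) - 1) * (1 - s ^ 4) ^ ((1 / 2 : ℝ) - 1)))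
      (fun s => 4 * (1 / √(1 - s ^ 4))) (Ioo 0 1) := by
    intro s hs
    have hs4 : s ^ 4 < 1 := pow_lt_one₀ hs.1.le hs.2 (by norm_num)
    have h1 : (s ^ 4) ^ ((1 / 4 : ℝ) - 1) = (s ^ 3)⁻¹ := by
      rw [← Real.rpow_natCast, ← Real.rpow_mul hs.1.le, ← Real.rpow_natCast,
        ← Real.rpow_neg hs.1.le]
      norm_num
    have h2 : (1 - s ^ 4) ^ ((1 / 2 : ℝ) - 1) = 1 / √(1 - s ^ 4) := by
      rw [show (1 / 2 : ℝ) - 1 = -(1 / 2) by norm_num, Real.rpow_neg (by linarith),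
        ← Real.sqrt_eq_rpow, one_div]
    have hs0 : 0 < s := hs.1
    simp only [smul_eq_mul]
    rw [h1, h2, abs_of_pos (by positivity)]
    field_simp
  obtain ⟨hInt, hval⟩ := integrableOn_rpow_mul_one_sub_rpow_and_integral_eq
    (a := 1 / 4) (b := 1 / 2) (by norm_num) (by norm_num)
  rw [← himage, integrableOn_image_iff_integrableOn_abs_deriv_smul measurableSet_Ioo hderiv hinj]
    at hInt
  rw [← himage, integral_image_eq_integral_abs_deriv_smul measurableSet_Ioo hderiv hinj,
    setIntegral_congr_fun measurableSet_Ioo hcongr, MeasureTheory.integral_const_mul,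
    Real.Gamma_one_fourth_mul_Gamma_half_div] at hval
  constructor
  · simpa [IntegrableOn] using
      ((hInt.congr_fun hcongr measurableSet_Ioo).integrable.const_mul (1 / 4))
  · rw [show Real.Gamma (1 / 4) ^ 2 / (4 * √2 * √Real.pi) =
      (Real.Gamma (1 / 4) ^ 2 / (√2 * √Real.pi)) / 4 by field_simp, ← hval]
    ring

theorem mul_period_integral_eq {A : ℝ} (hA : 0 < A) :
    A * (4 * ∫ u in (0:ℝ)..A, 1 / √((A ^ 2 - u ^ 2) * (1 + A ^ 2 / 2 + u ^ 2 / 2))) =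
      4 * ∫ s in Set.Ioo (0 : ℝ) 1, 1 / √((1 - s ^ 2) * ((A ^ 2)⁻¹ + 1 / 2 + s ^ 2 / 2)) := by
  have hscale := intervalIntegral.smul_integral_comp_mul_left (a := 0) (b := 1)
    (fun u : ℝ => 1 / √((A ^ 2 - u ^ 2) * (1 + A ^ 2 / 2 + u ^ 2 / 2))) A
  rw [mul_zero, mul_one] at hscale
  rw [← hscale, smul_eq_mul, ← MeasureTheory.integral_Ioc_eq_integral_Ioo,
    ← integral_of_le zero_le_one]
  have hpt : ∀ s : ℝ, 1 / √((A ^ 2 - (A * s) ^ 2) * (1 + A ^ 2 / 2 + (A * s) ^ 2 / 2)) =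
      (A ^ 2)⁻¹ * (1 / √((1 - s ^ 2) * ((A ^ 2)⁻¹ + 1 / 2 + s ^ 2 / 2))) := by
    intro s
    rw [show (A ^ 2 - (A * s) ^ 2) * (1 + A ^ 2 / 2 + (A * s) ^ 2 / 2) =
      (A ^ 2) ^ 2 * ((1 - s ^ 2) * ((A ^ 2)⁻¹ + 1 / 2 + s ^ 2 / 2)) by field_simp,
      Real.sqrt_mul (by positivity), Real.sqrt_sq (by positivity)]
    simp [mul_comm]
  simp only [hpt, intervalIntegral.integral_const_mul]
  field_simp

/-- asymptotics of the single-well period function: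
`A · P₊(A) → Γ(1/4)² / √π` as `A → ∞`. -/
theorem Pplus_asymptotics :
    Tendsto
      (fun A : ℝ =>
        A * (4 * ∫ u in (0:ℝ)..A,
          1 / Real.sqrt ((A ^ 2 - u ^ 2) * (1 + A ^ 2 / 2 + u ^ 2 / 2))))
      atTop (nhds (Real.Gamma (1/4) ^ 2 / Real.sqrt Real.pi)) := by
  obtain ⟨hInt, hval⟩ := integrableOn_one_div_sqrt_one_sub_pow_four_and_integral_eq
  have hsqrt : ∀ s : ℝ, √2 * (1 / √(1 - s ^ 4)) = 1 / √((1 - s ^ 2) * (1 / 2 + s ^ 2 / 2)) := by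
    intro s
    rw [show (1 - s ^ 2) * (1 / 2 + s ^ 2 / 2) = (1 - s ^ 4) / 2 by ring,
      Real.sqrt_div' _ zero_le_two, one_div_div, mul_one_div]
  have hlim : Real.Gamma (1 / 4) ^ 2 / √Real.pi =
      4 * ∫ s in Set.Ioo (0 : ℝ) 1, √2 * (1 / √(1 - s ^ 4)) := by
    rw [MeasureTheory.integral_const_mul, hval]
    field_simp
  rw [hlim]
  refine Tendsto.congr' ((eventually_gt_atTop 0).mono fun A hA => (mul_period_integral_eq hA).symm)
    (Tendsto.const_mul 4 ?_)
  refine MeasureTheory.tendsto_integral_filter_of_dominated_convergence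
    (fun s : ℝ => √2 * (1 / √(1 - s ^ 4))) (Eventually.of_forall fun A => ?_)
    (Eventually.of_forall fun A => ?_) (hInt.const_mul _) ?_
  · exact Measurable.aestronglyMeasurable (by fun_prop)
  · filter_upwards [MeasureTheory.ae_restrict_mem measurableSet_Ioo] with s hs
    have hs2 : 0 < 1 - s ^ 2 := by nlinarith [hs.1, hs.2]
    rw [hsqrt, Real.norm_of_nonneg (by positivity)]
    gcongr
    simp only [le_add_iff_nonneg_left]
    positivity
  · filter_upwards [MeasureTheory.ae_restrict_mem measurableSet_Ioo] with s hs
    have hs2 : 0 < 1 - s ^ 2 := by nlinarith [hs.1, hs.2]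
    rw [hsqrt]
    have hinv : Tendsto (fun A : ℝ => (A ^ 2)⁻¹) atTop (nhds 0) :=
      (tendsto_pow_atTop two_ne_zero).inv_tendsto_atTop
    have hadd : Tendsto (fun A : ℝ => (1 - s ^ 2) * ((A ^ 2)⁻¹ + 1 / 2 + s ^ 2 / 2)) atTop
        (nhds ((1 - s ^ 2) * (1 / 2 + s ^ 2 / 2))) := by
      simpa only [zero_add] using ((hinv.add_const (1 / 2)).add_const (s ^ 2 / 2)).const_mul (1 - s ^ 2)
    exact tendsto_const_nhds.div hadd.sqrt (by positivity)
end

section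
/- Define P₋ : (√2, ∞) → ℝ by P₋(A) = 4·∫₀^A du / √((A² − u²)·(A²/2 + u²/2 − 1)). Then lim_{A → ∞} A·P₋(A) = Γ(1/4)² / √π, where Γ denotes the Euler Gamma function. -/
open intervalIntegral Filter

lemma ofReal_betaIntegrand {u v x : ℝ} (hx : x ∈ Set.Ioo (0 : ℝ) 1) :
    (x : ℂ) ^ ((u : ℂ) - 1) * (1 - (x : ℂ)) ^ ((v : ℂ) - 1)
      = ((x ^ (u - 1) * (1 - x) ^ (v - 1) : ℝ) : ℂ) := by
  rw [Complex.ofReal_mul, Complex.ofReal_cpow hx.1.le, Complex.ofReal_cpow (sub_nonneg.2 hx.2.le)]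
  push_cast
  rfl

lemma integrableOn_betaIntegrand {u v : ℝ} (hu : 0 < u) (hv : 0 < v) :
    MeasureTheory.IntegrableOn (fun x : ℝ => x ^ (u - 1) * (1 - x) ^ (v - 1)) (Set.Ioo 0 1) := by
  have h := Complex.betaIntegral_convergent (u := u) (v := v) (by simpa) (by simpa)
  rw [intervalIntegrable_iff_integrableOn_Ioo_of_le zero_le_one] at h
  have h' := MeasureTheory.IntegrableOn.congr_fun h
    (fun x hx => ofReal_betaIntegrand hx) measurableSet_Ioo
  exact h'.re

lemma setIntegral_betaIntegrand {u v : ℝ} (hu : 0 < u) (hv : 0 < v) :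
    ∫ x in Set.Ioo (0 : ℝ) 1, x ^ (u - 1) * (1 - x) ^ (v - 1)
      = Real.Gamma u * Real.Gamma v / Real.Gamma (u + v) := by
  have h := ProbabilityTheory.beta_eq_betaIntegralReal u v hu hv
  rw [Complex.betaIntegral, integral_of_le zero_le_one, MeasureTheory.integral_Ioc_eq_integral_Ioo,
    MeasureTheory.setIntegral_congr_fun measurableSet_Ioo (fun x hx => ofReal_betaIntegrand hx),
    integral_complex_ofReal, Complex.ofReal_re] at h
  exact h.symm

lemma image_pow_four_Ioo : (fun s : ℝ => s ^ 4) '' Set.Ioo 0 1 = Set.Ioo 0 1 := by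
  ext y
  constructor
  · rintro ⟨s, ⟨h0, h1⟩, rfl⟩
    exact ⟨by positivity, pow_lt_one₀ h0.le h1 (by norm_num)⟩
  · rintro ⟨h0, h1⟩
    refine ⟨y ^ (1 / 4 : ℝ), ⟨by positivity, Real.rpow_lt_one h0.le h1 (by norm_num)⟩, ?_⟩
    dsimp only
    rw [← Real.rpow_natCast, ← Real.rpow_mul h0.le]
    norm_num

lemma injOn_pow_four_Ioo : Set.InjOn (fun s : ℝ => s ^ 4) (Set.Ioo 0 1) :=
  fun _ hx _ hy h => (pow_left_inj₀ hx.1.le hy.1.le (by norm_num)).1 h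

lemma lemniscate_integrand_eq {s : ℝ} (hs : s ∈ Set.Ioo (0 : ℝ) 1) :
    |4 * s ^ 3| • ((s ^ 4) ^ ((1 / 4 : ℝ) - 1) * (1 - s ^ 4) ^ ((1 / 2 : ℝ) - 1))
      = 4 * (1 / √(1 - s ^ 4)) := by
  have h0 := hs.1
  have h1 : 0 < 1 - s ^ 4 := sub_pos.2 (pow_lt_one₀ h0.le hs.2 (by norm_num))
  have e1 : (s ^ 4) ^ ((1 / 4 : ℝ) - 1) = (s ^ 3)⁻¹ := by
    rw [← Real.rpow_natCast, ← Real.rpow_natCast, ← Real.rpow_mul h0.le, ← Real.rpow_neg h0.le]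
    norm_num
  have e2 : (1 - s ^ 4) ^ ((1 / 2 : ℝ) - 1) = 1 / √(1 - s ^ 4) := by
    rw [Real.sqrt_eq_rpow, one_div (_ ^ _), ← Real.rpow_neg h1.le]
    norm_num
  rw [e1, e2, abs_of_pos (by positivity), smul_eq_mul]
  field_simp

lemma hasDerivWithinAt_pow_four (s : ℝ) (S : Set ℝ) :
    HasDerivWithinAt (fun s : ℝ => s ^ 4) (4 * s ^ 3) S s := by
  simpa using (hasDerivAt_pow 4 s).hasDerivWithinAt

lemma integrableOn_lemniscate :
    MeasureTheory.IntegrableOn (fun s : ℝ => 1 / √(1 - s ^ 4)) (Set.Ioo 0 1) := by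
  have h := integrableOn_betaIntegrand (u := 1 / 4) (v := 1 / 2) (by norm_num) (by norm_num)
  rw [← image_pow_four_Ioo, MeasureTheory.integrableOn_image_iff_integrableOn_abs_deriv_smul
    measurableSet_Ioo (fun s _ => hasDerivWithinAt_pow_four s _) injOn_pow_four_Ioo] at h
  have h' := (MeasureTheory.IntegrableOn.congr_fun h
    (fun s hs => lemniscate_integrand_eq hs) measurableSet_Ioo).const_mul (1 / 4)
  refine MeasureTheory.IntegrableOn.congr_fun h' (fun s _ => ?_) measurableSet_Ioo
  ring

lemma four_mul_integral_lemniscate :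
    4 * ∫ s in (0 : ℝ)..1, 1 / √(1 - s ^ 4)
      = Real.Gamma (1 / 4) * √Real.pi / Real.Gamma (3 / 4) := by
  have h := setIntegral_betaIntegrand (u := 1 / 4) (v := 1 / 2) (by norm_num) (by norm_num)
  rw [← image_pow_four_Ioo, MeasureTheory.integral_image_eq_integral_abs_deriv_smul
    measurableSet_Ioo (fun s _ => hasDerivWithinAt_pow_four s _) injOn_pow_four_Ioo,
    MeasureTheory.setIntegral_congr_fun measurableSet_Ioo (fun s hs => lemniscate_integrand_eq hs),
    MeasureTheory.integral_const_mul, Real.Gamma_one_half_eq] at h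
  rw [integral_of_le zero_le_one, MeasureTheory.integral_Ioc_eq_integral_Ioo, h]
  norm_num

lemma Gamma_one_fourth_mul_Gamma_three_fourths :
    Real.Gamma (1 / 4) * Real.Gamma (3 / 4) = √2 * Real.pi := by
  have h := Real.Gamma_mul_Gamma_one_sub (1 / 4)
  rw [show Real.pi * (1 / 4) = Real.pi / 4 by ring, Real.sin_pi_div_four] at h
  norm_num at h ⊢
  rw [h]
  have h2 : √2 * √2 = (2 : ℝ) := Real.mul_self_sqrt (by norm_num)
  field_simp
  linarith

lemma sqrt_two_mul_integral_lemniscate :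
    4 * (√2 * ∫ s in (0 : ℝ)..1, 1 / √(1 - s ^ 4)) = Real.Gamma (1 / 4) ^ 2 / √Real.pi := by
  have h := four_mul_integral_lemniscate
  have hΓ := Gamma_one_fourth_mul_Gamma_three_fourths
  have h3 : 0 < Real.Gamma (3 / 4) := Real.Gamma_pos_of_pos (by norm_num)
  have hπ : √Real.pi * √Real.pi = Real.pi := Real.mul_self_sqrt Real.pi_pos.le
  have hπ' : 0 < √Real.pi := Real.sqrt_pos.2 Real.pi_pos
  rw [mul_left_comm, h]
  field_simp
  rw [sq, hπ, hΓ]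

/-- The rescaling `u = A s` turns the period integral into one over `[0, 1]`. -/
lemma mul_integral_period_eq {A : ℝ} (hA : 0 < A) :
    A * ∫ u in (0 : ℝ)..A, 1 / √((A ^ 2 - u ^ 2) * (A ^ 2 / 2 + u ^ 2 / 2 - 1))
      = ∫ s in (0 : ℝ)..1, 1 / √((1 - s ^ 2) * (1 / 2 + s ^ 2 / 2 - (A ^ 2)⁻¹)) := by
  have h := smul_integral_comp_mul_left (a := 0) (b := 1)
    (fun u : ℝ => 1 / √((A ^ 2 - u ^ 2) * (A ^ 2 / 2 + u ^ 2 / 2 - 1))) A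
  rw [mul_zero, mul_one, smul_eq_mul] at h
  rw [← h, ← mul_assoc, ← integral_const_mul]
  congr 1
  ext s
  have e : (A ^ 2 - (A * s) ^ 2) * (A ^ 2 / 2 + (A * s) ^ 2 / 2 - 1)
      = (A ^ 2) ^ 2 * ((1 - s ^ 2) * (1 / 2 + s ^ 2 / 2 - (A ^ 2)⁻¹)) := by
    field_simp
  rw [e, Real.sqrt_mul (by positivity), Real.sqrt_sq (by positivity)]
  field_simp

lemma norm_rescaled_integrand_le {A s : ℝ} (hA : 2 ≤ A) (hs : s ∈ Set.Ioo (0 : ℝ) 1) :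
    ‖1 / √((1 - s ^ 2) * (1 / 2 + s ^ 2 / 2 - (A ^ 2)⁻¹))‖ ≤ 2 * (1 / √(1 - s ^ 4)) := by
  have h1 : 0 < 1 - s ^ 4 := sub_pos.2 (pow_lt_one₀ hs.1.le hs.2 (by norm_num))
  have h2 : 0 < 1 - s ^ 2 := sub_pos.2 (pow_lt_one₀ hs.1.le hs.2 (by norm_num))
  have hi : (A ^ 2)⁻¹ ≤ 1 / 4 := by
    rw [inv_le_comm₀ (by positivity) (by norm_num)]
    nlinarith
  have hle : 1 - s ^ 4 ≤ 2 ^ 2 * ((1 - s ^ 2) * (1 / 2 + s ^ 2 / 2 - (A ^ 2)⁻¹)) := by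
    nlinarith [mul_nonneg h2.le (sub_nonneg.2 hi), mul_nonneg h2.le (sq_nonneg s)]
  have hsq := Real.sqrt_le_sqrt hle
  rw [Real.sqrt_mul (by norm_num), Real.sqrt_sq (by norm_num)] at hsq
  have hp := Real.sqrt_pos.2 h1
  rw [Real.norm_of_nonneg (by positivity), mul_one_div, div_le_div_iff₀ (by linarith) hp]
  linarith

lemma tendsto_rescaled_integrand {s : ℝ} (hs : s ∈ Set.Ioo (0 : ℝ) 1) :
    Tendsto (fun A : ℝ => 1 / √((1 - s ^ 2) * (1 / 2 + s ^ 2 / 2 - (A ^ 2)⁻¹))) atTop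
      (nhds (√2 * (1 / √(1 - s ^ 4)))) := by
  have h1 : 0 < 1 - s ^ 4 := sub_pos.2 (pow_lt_one₀ hs.1.le hs.2 (by norm_num))
  have hinv : Tendsto (fun A : ℝ => (A ^ 2)⁻¹) atTop (nhds 0) :=
    tendsto_inv_atTop_zero.comp (tendsto_pow_atTop (by norm_num))
  have e : (1 - s ^ 2) * (1 / 2 + s ^ 2 / 2 - 0) = (1 - s ^ 4) / 2 := by ring
  have hlim := ((hinv.const_sub (1 / 2 + s ^ 2 / 2)).const_mul (1 - s ^ 2)).sqrt
  rw [e] at hlim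
  have e' : √2 * (1 / √(1 - s ^ 4)) = 1 / √((1 - s ^ 4) / 2) := by
    rw [Real.sqrt_div h1.le]
    field_simp
  rw [e']
  exact tendsto_const_nhds.div hlim (Real.sqrt_pos.2 (half_pos h1)).ne'

/-- asymptotics of the double-well period function:
`A · P₋(A) → Γ(1/4)² / √π` as `A → ∞`. -/
theorem Pminus_asymptotics :
    Tendsto
      (fun A : ℝ =>
        A * (4 * ∫ u in (0:ℝ)..A,
          1 / Real.sqrt ((A ^ 2 - u ^ 2) * (A ^ 2 / 2 + u ^ 2 / 2 - 1))))
      atTop (nhds (Real.Gamma (1/4) ^ 2 / Real.sqrt Real.pi)) := by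
  have key : Tendsto
      (fun A : ℝ => ∫ s in (0 : ℝ)..1, 1 / √((1 - s ^ 2) * (1 / 2 + s ^ 2 / 2 - (A ^ 2)⁻¹)))
      atTop (nhds (∫ s in (0 : ℝ)..1, √2 * (1 / √(1 - s ^ 4)))) := by
    simp only [integral_of_le zero_le_one, MeasureTheory.integral_Ioc_eq_integral_Ioo]
    refine MeasureTheory.tendsto_integral_filter_of_dominated_convergence
      (fun s => 2 * (1 / √(1 - s ^ 4))) ?_ ?_ (integrableOn_lemniscate.const_mul 2) ?_
    · exact Eventually.of_forall fun A => Measurable.aestronglyMeasurable (by fun_prop)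
    · filter_upwards [eventually_ge_atTop 2] with A hA
      exact MeasureTheory.ae_restrict_of_forall_mem measurableSet_Ioo
        fun s hs => norm_rescaled_integrand_le hA hs
    · exact MeasureTheory.ae_restrict_of_forall_mem measurableSet_Ioo
        fun s hs => tendsto_rescaled_integrand hs
  rw [integral_const_mul] at key
  rw [← sqrt_two_mul_integral_lemniscate]
  refine (key.const_mul 4).congr' ?_
  filter_upwards [eventually_gt_atTop 0] with A hA
  rw [← mul_integral_period_eq hA, mul_left_comm]
end
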